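/- arXiv:1408.1929 — 8 statements merged into one kernel-verified Lean document; each statement's English description precedes it below -/
import Mathlib

section
/- Routh's theorem (cevian-foot triangle): The area of triangle KLM equals (1+xyz)/((1+x)(1+y)(1+z)) times the area of triangle ABC. -/
open MeasureTheory
open scoped Pointwise

/-- The area of a triangle is a determinant in the coordinates of its vertices times the area of
the standard triangle. -/
theorem volume_convexHull_triple (P Q R : EuclideanSpace ℝ (Fin 2)) :
    volume (convexHull ℝ ({P, Q, R} : Set (EuclideanSpace ℝ (Fin 2)))) =
      ENNReal.ofReal |(Q 0 - P 0) * (R 1 - P 1) - (Q 1 - P 1) * (R 0 - P 0)| *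
        volume (convexHull ℝ ({0, EuclideanSpace.single 0 1, EuclideanSpace.single 1 1} :
          Set (EuclideanSpace ℝ (Fin 2)))) := by
  let b := (EuclideanSpace.basisFun (Fin 2) ℝ).toBasis
  let f := b.constr ℝ ![Q - P, R - P]
  have hf0 : f (EuclideanSpace.single 0 1) = Q - P := by
    have h := b.constr_basis ℝ ![Q - P, R - P] 0
    rwa [OrthonormalBasis.coe_toBasis, EuclideanSpace.basisFun_apply] at h
  have hf1 : f (EuclideanSpace.single 1 1) = R - P := by
    have h := b.constr_basis ℝ ![Q - P, R - P] 1
    rwa [OrthonormalBasis.coe_toBasis, EuclideanSpace.basisFun_apply] at h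
  have hdet : LinearMap.det f =
      (Q 0 - P 0) * (R 1 - P 1) - (Q 1 - P 1) * (R 0 - P 0) := by
    rw [← LinearMap.det_toMatrix b, Matrix.det_fin_two]
    simp only [LinearMap.toMatrix_apply]
    simp [b, hf0, hf1]
    ring
  have htranslate : ({P, Q, R} : Set (EuclideanSpace ℝ (Fin 2))) =
      P +ᵥ ({0, Q - P, R - P} : Set (EuclideanSpace ℝ (Fin 2))) := by
    simp [← Set.image_vadd, Set.image_insert_eq]
  rw [← hdet, ← Measure.addHaar_image_linearMap, f.image_convexHull, Set.image_insert_eq,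
    Set.image_pair, hf0, hf1, map_zero, htranslate, convexHull_vadd, measure_vadd]

/-- The point dividing a nondegenerate segment `AB` in the ratio `x : 1`. -/
theorem smul_eq_of_mem_segment_of_dist_eq {E : Type*} [NormedAddCommGroup E] [NormedSpace ℝ E]
    {A B M : E} {x : ℝ} (hx : 0 < x) (hAB : A ≠ B) (hM : M ∈ segment ℝ A B)
    (h : dist A M = x * dist M B) : M = (1 / (1 + x)) • A + (x / (1 + x)) • B := by
  obtain ⟨t, ht, rfl⟩ := segment_eq_image_lineMap ℝ A B ▸ hM
  rw [dist_left_lineMap, dist_lineMap_right, Real.norm_of_nonneg ht.1,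
    Real.norm_of_nonneg (sub_nonneg.2 ht.2), ← mul_assoc] at h
  have ht' := mul_right_cancel₀ (dist_ne_zero.2 hAB) h
  have hx' : 1 + x ≠ 0 := by positivity
  have e : t = x / (1 + x) := by
    field_simp
    linarith
  rw [AffineMap.lineMap_apply_module, e, show 1 - x / (1 + x) = 1 / (1 + x) by field_simp; ring]

/-- **Routh's theorem (cevian-foot triangle).** The area of the triangle `KLM` equals
`(1+xyz)/((1+x)(1+y)(1+z))` times the area of the triangle `ABC`. -/
theorem routh_cevian_foot_triangle
    (A B C K L M : EuclideanSpace ℝ (Fin 2))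
    (x y z : ℝ) (hx : 0 < x) (hy : 0 < y) (hz : 0 < z)
    (hABC : AffineIndependent ℝ ![A, B, C])
    (hM : M ∈ segment ℝ A B) (hMr : dist A M = x * dist M B)
    (hK : K ∈ segment ℝ B C) (hKr : dist B K = y * dist K C)
    (hL : L ∈ segment ℝ C A) (hLr : dist C L = z * dist L A) :
    volume (convexHull ℝ ({K, L, M} : Set (EuclideanSpace ℝ (Fin 2)))) =
      ENNReal.ofReal ((1 + x * y * z) / ((1 + x) * (1 + y) * (1 + z))) *
        volume (convexHull ℝ ({A, B, C} : Set (EuclideanSpace ℝ (Fin 2)))) := by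
  have hAB : A ≠ B := hABC.injective.ne (show (0 : Fin 3) ≠ 1 by decide)
  have hBC : B ≠ C := hABC.injective.ne (show (1 : Fin 3) ≠ 2 by decide)
  have hCA : C ≠ A := hABC.injective.ne (show (2 : Fin 3) ≠ 0 by decide)
  have hr : 0 ≤ (1 + x * y * z) / ((1 + x) * (1 + y) * (1 + z)) := by positivity
  rw [smul_eq_of_mem_segment_of_dist_eq hx hAB hM hMr,
    smul_eq_of_mem_segment_of_dist_eq hy hBC hK hKr,
    smul_eq_of_mem_segment_of_dist_eq hz hCA hL hLr,
    volume_convexHull_triple, volume_convexHull_triple A B C, ← mul_assoc,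
    ← ENNReal.ofReal_mul hr, ← abs_of_nonneg hr, ← abs_mul]
  congr 3
  simp only [PiLp.add_apply, PiLp.smul_apply, smul_eq_mul]
  field_simp
  ring
end

section
/- Routh's theorem (inner triangle): The area of triangle PQR equals (1−xyz)²/((1+x+xy)(1+y+yz)(1+z+zx)) times the area of triangle ABC. -/
open MeasureTheory

section AffineGeometry

variable {V : Type*}

theorem affineIndependent_rotate {k : Type*} [Ring k] [AddCommGroup V] [Module k V] {A B C : V}
    (h : AffineIndependent k ![A, B, C]) : AffineIndependent k ![B, C, A] := by
  convert h.comp_embedding (finRotate 3).toEmbedding using 1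
  ext i
  fin_cases i <;> rfl

theorem linearIndependent_sub_of_affineIndependent {k : Type*} [Ring k] [AddCommGroup V]
    [Module k V] {A B C : V} (h : AffineIndependent k ![A, B, C]) :
    LinearIndependent k ![B - A, C - A] := by
  have h' := (affineIndependent_iff_linearIndependent_vsub k _ (0 : Fin 3)).1 h
  convert h'.comp (fun i : Fin 2 => (⟨i.succ, Fin.succ_ne_zero i⟩ : {j : Fin 3 // j ≠ 0}))
    (fun i j hij => Fin.succ_injective _ (congrArg Subtype.val hij)) using 1
  ext i
  fin_cases i <;> rfl

/-- A point dividing the segment `AB` in the ratio `r : 1` is the corresponding weighted mean. -/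
theorem one_add_smul_eq_of_dist_eq_mul_dist [NormedAddCommGroup V] [NormedSpace ℝ V]
    {A B M : V} {r : ℝ} (hAB : A ≠ B) (hM : M ∈ segment ℝ A B)
    (hr : dist A M = r * dist M B) : (1 + r) • M = A + r • B := by
  obtain ⟨a, b, ha, hb, hab, rfl⟩ := hM
  obtain rfl : a = 1 - b := by linarith
  have hAM : A - ((1 - b) • A + b • B) = b • (A - B) := by module
  have hMB : (1 - b) • A + b • B - B = (1 - b) • (A - B) := by module
  rw [dist_eq_norm, dist_eq_norm, hAM, hMB, norm_smul, norm_smul, Real.norm_of_nonneg ha,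
    Real.norm_of_nonneg hb, ← mul_assoc] at hr
  have hb' : b = r * (1 - b) := mul_right_cancel₀ (norm_ne_zero_iff.2 (sub_ne_zero.2 hAB)) hr
  have hcoef : (1 + r) * b = r := by linarith
  linear_combination (norm := module) hcoef • (B - A)

/-- Barycentric coordinates of the intersection of the cevians `AK` and `CM`. -/
theorem smul_cevian_inter_eq [AddCommGroup V] [Module ℝ V] {A B C K M P : V} {x y : ℝ}
    (hx : 0 < x) (hy : 0 < y) (hABC : AffineIndependent ℝ ![A, B, C])
    (hM : (1 + x) • M = A + x • B) (hK : (1 + y) • K = B + y • C)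
    (hP₁ : P ∈ affineSpan ℝ ({A, K} : Set V)) (hP₂ : P ∈ affineSpan ℝ ({C, M} : Set V)) :
    (1 + x + x * y) • P = A + x • B + (x * y) • C := by
  obtain ⟨p, rfl⟩ := mem_affineSpan_pair_iff_exists_lineMap_eq.1 hP₁
  obtain ⟨q, hq⟩ := mem_affineSpan_pair_iff_exists_lineMap_eq.1 hP₂
  obtain ⟨s, rfl⟩ : ∃ s, p = s * (1 + y) := ⟨p / (1 + y), by field_simp⟩
  obtain ⟨t, rfl⟩ : ∃ t, q = t * (1 + x) := ⟨q / (1 + x), by field_simp⟩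
  simp only [AffineMap.lineMap_apply_module'] at hq ⊢
  have hli := LinearIndependent.pair_iff.1 (linearIndependent_sub_of_affineIndependent hABC)
  obtain ⟨h₁, h₂⟩ := hli (s - t * x) (s * y - 1 + t * (1 + x)) (by
    linear_combination (norm := module) -hq + t • hM - s • hK)
  have hs : s * (1 + x + x * y) = x := by linear_combination (1 + x) * h₁ + x * h₂
  linear_combination (norm := module)
    ((1 + x + x * y) * s) • hK + hs • (B + y • C - (1 + y) • A)

end AffineGeometry

/-- The area of a triangle `PQR`, given the coordinates of its edge vectors in the
frame of `ABC`. -/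
theorem volume_convexHull_triple_eq {A B C P Q R : EuclideanSpace ℝ (Fin 2)}
    (hABC : AffineIndependent ℝ ![A, B, C]) {a b c d : ℝ}
    (hQ : Q - P = a • (B - A) + b • (C - A)) (hR : R - P = c • (B - A) + d • (C - A)) :
    volume (convexHull ℝ {P, Q, R}) =
      ENNReal.ofReal |a * d - b * c| * volume (convexHull ℝ {A, B, C}) := by
  let e := basisOfLinearIndependentOfCardEqFinrank
    (linearIndependent_sub_of_affineIndependent hABC) (by simp)
  let f := Matrix.toLin e e !![a, c; b, d]
  have he₀ : e 0 = B - A := by simp [e]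
  have he₁ : e 1 = C - A := by simp [e]
  have hf₀ : f (B - A) = Q - P := by
    rw [← he₀, hQ, Matrix.toLin_self]; simp [he₀, he₁]
  have hf₁ : f (C - A) = R - P := by
    rw [← he₁, hR, Matrix.toLin_self]; simp [he₀, he₁]
  have hdet : LinearMap.det f = a * d - b * c := by
    rw [LinearMap.det_toLin, Matrix.det_fin_two_of]; ring
  let g : EuclideanSpace ℝ (Fin 2) →ᵃ[ℝ] EuclideanSpace ℝ (Fin 2) :=
    f.toAffineMap + AffineMap.const ℝ _ (P - f A)
  have hgv (v) : g v = f v + (P - f A) := rfl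
  have hg : ({P, Q, R} : Set (EuclideanSpace ℝ (Fin 2))) = g '' {A, B, C} := by
    have hB : g B = Q := by
      rw [map_sub] at hf₀
      rw [hgv]
      linear_combination (norm := module) hf₀
    have hC : g C = R := by
      rw [map_sub] at hf₁
      rw [hgv]
      linear_combination (norm := module) hf₁
    have hA : g A = P := by simp [hgv]
    simp only [Set.image_insert_eq, Set.image_singleton, hA, hB, hC]
  have himage : g '' convexHull ℝ {A, B, C} =
      (fun v => v + (P - f A)) '' (f '' convexHull ℝ {A, B, C}) := by
    simp only [Set.image_image, hgv]
  rw [hg, ← AffineMap.image_convexHull, himage, Set.image_add_right, measure_preimage_add_right,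
    Measure.addHaar_image_linearMap, hdet]

/-- **Routh's theorem (inner triangle).** The area of the triangle `PQR` cut out by the
cevians `AK`, `BL`, `CM` equals `(1-xyz)²/((1+x+xy)(1+y+yz)(1+z+zx))` times the area of
the triangle `ABC`. -/
theorem routh_inner_triangle
    (A B C K L M P Q R : EuclideanSpace ℝ (Fin 2))
    (x y z : ℝ) (hx : 0 < x) (hy : 0 < y) (hz : 0 < z)
    (hABC : AffineIndependent ℝ ![A, B, C])
    (hM : M ∈ segment ℝ A B) (hMr : dist A M = x * dist M B)
    (hK : K ∈ segment ℝ B C) (hKr : dist B K = y * dist K C)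
    (hL : L ∈ segment ℝ C A) (hLr : dist C L = z * dist L A)
    (hP₁ : P ∈ affineSpan ℝ ({A, K} : Set (EuclideanSpace ℝ (Fin 2))))
    (hP₂ : P ∈ affineSpan ℝ ({C, M} : Set (EuclideanSpace ℝ (Fin 2))))
    (hQ₁ : Q ∈ affineSpan ℝ ({B, L} : Set (EuclideanSpace ℝ (Fin 2))))
    (hQ₂ : Q ∈ affineSpan ℝ ({A, K} : Set (EuclideanSpace ℝ (Fin 2))))
    (hR₁ : R ∈ affineSpan ℝ ({C, M} : Set (EuclideanSpace ℝ (Fin 2))))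
    (hR₂ : R ∈ affineSpan ℝ ({B, L} : Set (EuclideanSpace ℝ (Fin 2)))) :
    volume (convexHull ℝ ({P, Q, R} : Set (EuclideanSpace ℝ (Fin 2)))) =
      ENNReal.ofReal ((1 - x * y * z) ^ 2 /
          ((1 + x + x * y) * (1 + y + y * z) * (1 + z + z * x))) *
        volume (convexHull ℝ ({A, B, C} : Set (EuclideanSpace ℝ (Fin 2)))) := by
  have hBCA := affineIndependent_rotate hABC
  have hCAB := affineIndependent_rotate hBCA
  have hAB : A ≠ B := hABC.injective.ne (show (0 : Fin 3) ≠ 1 by decide)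
  have hBC : B ≠ C := hBCA.injective.ne (show (0 : Fin 3) ≠ 1 by decide)
  have hCA : C ≠ A := hCAB.injective.ne (show (0 : Fin 3) ≠ 1 by decide)
  have hM' := one_add_smul_eq_of_dist_eq_mul_dist hAB hM hMr
  have hK' := one_add_smul_eq_of_dist_eq_mul_dist hBC hK hKr
  have hL' := one_add_smul_eq_of_dist_eq_mul_dist hCA hL hLr
  have hP := smul_cevian_inter_eq hx hy hABC hM' hK' hP₁ hP₂
  have hQ := smul_cevian_inter_eq hy hz hBCA hK' hL' hQ₁ hQ₂
  have hR := smul_cevian_inter_eq hz hx hCAB hL' hM' hR₁ hR₂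
  have hp : 0 < 1 + x + x * y := by positivity
  have hq : 0 < 1 + y + y * z := by positivity
  have hr : 0 < 1 + z + z * x := by positivity
  rw [← eq_inv_smul_iff₀ hp.ne'] at hP
  rw [← eq_inv_smul_iff₀ hq.ne'] at hQ
  rw [← eq_inv_smul_iff₀ hr.ne'] at hR
  rw [volume_convexHull_triple_eq hABC
    (a := 1 / (1 + y + y * z) - x / (1 + x + x * y))
    (b := y / (1 + y + y * z) - x * y / (1 + x + x * y))
    (c := z * x / (1 + z + z * x) - x / (1 + x + x * y))
    (d := 1 / (1 + z + z * x) - x * y / (1 + x + x * y))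
    (by rw [hP, hQ]; match_scalars <;> field_simp; ring)
    (by rw [hP, hR]; match_scalars <;> field_simp; ring)]
  congr 2
  rw [← abs_of_nonneg (show 0 ≤ (1 - x * y * z) ^ 2 /
    ((1 + x + x * y) * (1 + y + y * z) * (1 + z + z * x)) by positivity)]
  congr 1
  field_simp
  ring
end

section
/- Ceva's theorem: The three lines AK, BL and CM have a common point if and only if xyz = 1. -/
theorem eq_lineMap_of_mem_segment_of_dist_eq {E : Type*} [NormedAddCommGroup E] [NormedSpace ℝ E]
    {A B M : E} {x : ℝ} (hx : 0 < x) (hAB : A ≠ B) (hM : M ∈ segment ℝ A B)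
    (h : dist A M = x * dist M B) : M = AffineMap.lineMap A B (x / (1 + x)) := by
  rw [segment_eq_image_lineMap] at hM
  obtain ⟨t, ⟨ht0, ht1⟩, rfl⟩ := hM
  rw [dist_left_lineMap, dist_lineMap_right, Real.norm_of_nonneg ht0,
    Real.norm_of_nonneg (sub_nonneg.2 ht1), ← mul_assoc] at h
  have ht := mul_right_cancel₀ (dist_ne_zero.2 hAB) h
  congr 1
  rw [eq_div_iff (by positivity)]
  linarith

theorem AffineIndependent.eq_zero_of_smul_add_smul_eq_zero {k V : Type*} [CommRing k]
    [AddCommGroup V] [Module k V] {A B C : V} (h : AffineIndependent k ![A, B, C]) {a b : k}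
    (hab : a • (B - A) + b • (C - A) = 0) : a = 0 ∧ b = 0 := by
  rw [affineIndependent_iff] at h
  have key := h Finset.univ ![-(a + b), a, b] (by simp [Fin.sum_univ_three])
    (by
      rw [← hab]
      simp only [Fin.sum_univ_three, Matrix.cons_val]
      module)
  exact ⟨key 1 (Finset.mem_univ _), key 2 (Finset.mem_univ _)⟩


/-- **Ceva's theorem.** The three cevians `AK`, `BL`, `CM` of the triangle `ABC` have a
common point if and only if `xyz = 1`. -/
theorem ceva_theorem
    (A B C K L M : EuclideanSpace ℝ (Fin 2))
    (x y z : ℝ) (hx : 0 < x) (hy : 0 < y) (hz : 0 < z)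
    (hABC : AffineIndependent ℝ ![A, B, C])
    (hM : M ∈ segment ℝ A B) (hMr : dist A M = x * dist M B)
    (hK : K ∈ segment ℝ B C) (hKr : dist B K = y * dist K C)
    (hL : L ∈ segment ℝ C A) (hLr : dist C L = z * dist L A) :
    (∃ P : EuclideanSpace ℝ (Fin 2),
        P ∈ affineSpan ℝ ({A, K} : Set (EuclideanSpace ℝ (Fin 2))) ∧
        P ∈ affineSpan ℝ ({B, L} : Set (EuclideanSpace ℝ (Fin 2))) ∧
        P ∈ affineSpan ℝ ({C, M} : Set (EuclideanSpace ℝ (Fin 2)))) ↔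
      x * y * z = 1 := by
  have hAB : A ≠ B := hABC.injective.ne (by decide : (0 : Fin 3) ≠ 1)
  have hBC : B ≠ C := hABC.injective.ne (by decide : (1 : Fin 3) ≠ 2)
  have hCA : C ≠ A := hABC.injective.ne (by decide : (2 : Fin 3) ≠ 0)
  obtain rfl := eq_lineMap_of_mem_segment_of_dist_eq hx hAB hM hMr
  obtain rfl := eq_lineMap_of_mem_segment_of_dist_eq hy hBC hK hKr
  obtain rfl := eq_lineMap_of_mem_segment_of_dist_eq hz hCA hL hLr
  simp only [mem_affineSpan_pair_iff_exists_lineMap_eq]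
  constructor
  · rintro ⟨P, ⟨r, hr⟩, ⟨s, hs⟩, ⟨t, ht⟩⟩
    have hrs := hr.trans hs.symm
    have hrt := hr.trans ht.symm
    simp only [AffineMap.lineMap_apply_module] at hrs hrt
    obtain ⟨h₁, h₂⟩ := hABC.eq_zero_of_smul_add_smul_eq_zero
      (a := r / (1 + y) - (1 - s)) (b := r * y / (1 + y) - s / (1 + z)) (by
        rw [← sub_eq_zero] at hrs
        rw [← hrs]
        match_scalars <;> field_simp <;> ring)
    obtain ⟨h₃, h₄⟩ := hABC.eq_zero_of_smul_add_smul_eq_zero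
      (a := r / (1 + y) - t * x / (1 + x)) (b := r * y / (1 + y) - (1 - t)) (by
        rw [← sub_eq_zero] at hrt
        rw [← hrt]
        match_scalars <;> field_simp <;> ring)
    obtain ⟨p, rfl⟩ : ∃ p, r = p * (1 + y) := ⟨r / (1 + y), by field_simp⟩
    obtain ⟨q, rfl⟩ : ∃ q, s = q * (1 + z) := ⟨s / (1 + z), by field_simp⟩
    obtain ⟨c, rfl⟩ : ∃ c, t = c * (1 + x) := ⟨t / (1 + x), by field_simp⟩
    have e₁ : p = 1 - q * (1 + z) := by field_simp at h₁; linarith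
    have e₂ : q = p * y := by field_simp at h₂; linarith
    have e₃ : p = c * x := by field_simp at h₃; linarith
    have e₄ : p * y = 1 - c * (1 + x) := by field_simp at h₄; linarith
    have hp : p * (1 + y + y * z) = 1 := by rw [e₂] at e₁; linarith
    have hp0 : p ≠ 0 := left_ne_zero_of_mul_eq_one hp
    apply mul_left_cancel₀ hp0
    linear_combination x * hp - x * e₄ - (1 + x) * e₃
  · intro h
    have hz' : z = 1 / (x * y) := by field_simp; linarith
    subst hz'
    refine ⟨_, ⟨x * (1 + y) / (1 + x + x * y), rfl⟩,
      ⟨(1 + x * y) / (1 + x + x * y), ?_⟩, ⟨(1 + x) / (1 + x + x * y), ?_⟩⟩ <;>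
    · simp only [AffineMap.lineMap_apply_module]
      match_scalars <;> field_simp <;> ring
end

section
/- Menelaus' theorem: The points K, L, M are collinear if and only if xyz = −1. -/
/-- Three points of the plane are collinear iff the signed area they span vanishes. -/
theorem collinear_iff_cross_eq_zero (P Q R : EuclideanSpace ℝ (Fin 2)) :
    Collinear ℝ ({P, Q, R} : Set (EuclideanSpace ℝ (Fin 2))) ↔
      (Q 0 - P 0) * (R 1 - P 1) - (Q 1 - P 1) * (R 0 - P 0) = 0 := by
  rw [collinear_iff_of_mem (p₀ := P) (by simp)]
  constructor
  · rintro ⟨v, hv⟩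
    obtain ⟨s, rfl⟩ := hv Q (by simp)
    obtain ⟨t, rfl⟩ := hv R (by simp)
    simp only [vadd_eq_add, PiLp.add_apply, PiLp.smul_apply, smul_eq_mul]
    ring
  · intro h
    by_cases hQ : Q = P
    · subst hQ
      refine ⟨R - Q, ?_⟩
      rintro p (rfl | rfl | rfl)
      · exact ⟨0, by simp⟩
      · exact ⟨0, by simp⟩
      · exact ⟨1, by simp⟩
    · refine ⟨Q - P, ?_⟩
      rintro p (rfl | rfl | rfl)
      · exact ⟨0, by simp⟩
      · exact ⟨1, by simp⟩
      · by_cases h₀ : Q 0 - P 0 = 0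
        · have h₁ : Q 1 - P 1 ≠ 0 := fun h₁ => hQ <| by
            ext i
            fin_cases i
            · exact sub_eq_zero.mp h₀
            · exact sub_eq_zero.mp h₁
          refine ⟨(p 1 - P 1) / (Q 1 - P 1), ?_⟩
          ext i
          fin_cases i <;>
            simp only [Fin.zero_eta, Fin.mk_one, vadd_eq_add, PiLp.add_apply, PiLp.smul_apply,
              PiLp.sub_apply, smul_eq_mul] <;> field_simp
          · linear_combination -h
          · ring
        · refine ⟨(p 0 - P 0) / (Q 0 - P 0), ?_⟩
          ext i
          fin_cases i <;>
            simp only [Fin.zero_eta, Fin.mk_one, vadd_eq_add, PiLp.add_apply, PiLp.smul_apply,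
              PiLp.sub_apply, smul_eq_mul] <;> field_simp
          · ring
          · linear_combination h

/-- The coordinates of the point dividing a segment in a given signed ratio. -/
theorem apply_eq_div_of_sub_eq_smul_sub {ι : Type*} {A B M : EuclideanSpace ℝ ι} {x : ℝ}
    (hx : x ≠ -1) (hM : M - A = x • (B - M)) (i : ι) :
    M i = (A i + x * B i) / (1 + x) := by
  have hx' : 1 + x ≠ 0 := fun h => hx (by linarith)
  have h := congrArg (fun v : EuclideanSpace ℝ ι => v i) hM
  simp only [PiLp.smul_apply, PiLp.sub_apply, smul_eq_mul] at h
  rw [eq_div_iff hx']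
  linear_combination h

/-- **Menelaus' theorem.** With signed ratios `x = AM/MB`, `y = BK/KC`, `z = CL/LA`
(each different from `-1`), the points `K`, `L`, `M` are collinear if and only if
`xyz = -1`. -/
theorem menelaus_theorem
    (A B C K L M : EuclideanSpace ℝ (Fin 2))
    (x y z : ℝ) (hx : x ≠ -1) (hy : y ≠ -1) (hz : z ≠ -1)
    (hABC : AffineIndependent ℝ ![A, B, C])
    (hM : M - A = x • (B - M))
    (hK : K - B = y • (C - K))
    (hL : L - C = z • (A - L)) :
    Collinear ℝ ({K, L, M} : Set (EuclideanSpace ℝ (Fin 2))) ↔ x * y * z = -1 := by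
  rw [affineIndependent_iff_not_collinear_set, collinear_iff_cross_eq_zero] at hABC
  rw [collinear_iff_cross_eq_zero]
  have hx' : 1 + x ≠ 0 := fun h => hx (by linarith)
  have hy' : 1 + y ≠ 0 := fun h => hy (by linarith)
  have hz' : 1 + z ≠ 0 := fun h => hz (by linarith)
  have key : (L 0 - K 0) * (M 1 - K 1) - (L 1 - K 1) * (M 0 - K 0) =
      (1 + x * y * z) * ((B 0 - A 0) * (C 1 - A 1) - (B 1 - A 1) * (C 0 - A 0)) /
        ((1 + x) * (1 + y) * (1 + z)) := by
    simp only [apply_eq_div_of_sub_eq_smul_sub hx hM, apply_eq_div_of_sub_eq_smul_sub hy hK,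
      apply_eq_div_of_sub_eq_smul_sub hz hL]
    field_simp
    ring
  rw [key, div_eq_zero_iff, or_iff_left (mul_ne_zero (mul_ne_zero hx' hy') hz'), mul_eq_zero,
    or_iff_left hABC, add_comm, add_eq_zero_iff_eq_neg]
end

section
/- Routh's theorem for tetrahedra, first part: The volume of the tetrahedron P1P2P3P4 equals |1 − x1x2x3x4| / ((1+x1)(1+x2)(1+x3)(1+x4)) times the volume of the tetrahedron A1A2A3A4. -/
open MeasureTheory

/-- The point dividing the segment `AB` in the ratio `x : 1`. -/
lemma eq_smul_of_mem_segment_of_dist_eq {E : Type*} [NormedAddCommGroup E] [NormedSpace ℝ E]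
    {A B P : E} {x : ℝ} (hx : 0 < x) (hAB : A ≠ B) (hP : P ∈ segment ℝ A B)
    (h : dist A P = x * dist P B) : P = A + (x / (1 + x)) • (B - A) := by
  rw [segment_eq_image'] at hP
  obtain ⟨t, ⟨ht0, ht1⟩, rfl⟩ := hP
  have hBA : 0 < ‖B - A‖ := norm_pos_iff.2 (sub_ne_zero.2 hAB.symm)
  have hA : dist A (A + t • (B - A)) = t * ‖B - A‖ := by
    rw [dist_self_add_right, norm_smul, Real.norm_of_nonneg ht0]
  have hB : dist (A + t • (B - A)) B = (1 - t) * ‖B - A‖ := by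
    rw [dist_comm, dist_eq_norm, show B - (A + t • (B - A)) = (1 - t) • (B - A) by module,
      norm_smul, Real.norm_of_nonneg (sub_nonneg.2 ht1)]
  simp only [hA, hB, ← mul_assoc] at h
  have ht : t = x * (1 - t) := mul_right_cancel₀ hBA.ne' h
  have : t = x / (1 + x) := by
    rw [eq_div_iff (by positivity)]
    linarith
  rw [this]

open scoped Pointwise in
/-- The convex hull of four points has the same volume as its translate taking the first point to
the origin. -/
lemma volume_convexHull_eq_volume_convexHull_sub (A B C D : EuclideanSpace ℝ (Fin 3)) :
    volume (convexHull ℝ ({A, B, C, D} : Set (EuclideanSpace ℝ (Fin 3)))) =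
      volume (convexHull ℝ ({0, B - A, C - A, D - A} : Set (EuclideanSpace ℝ (Fin 3)))) := by
  have : ({A, B, C, D} : Set (EuclideanSpace ℝ (Fin 3))) =
      A +ᵥ ({0, B - A, C - A, D - A} : Set (EuclideanSpace ℝ (Fin 3))) := by
    simp [← Set.image_vadd, Set.image_insert_eq]
  rw [this, convexHull_vadd, measure_vadd]

/-- The volume of a tetrahedron whose edge vectors are given by a matrix in the basis of edge
vectors of another tetrahedron. -/
lemma volume_convexHull_eq_abs_det_mul (A P : Fin 4 → EuclideanSpace ℝ (Fin 3))
    (hA : AffineIndependent ℝ A) (M : Matrix (Fin 3) (Fin 3) ℝ)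
    (hP : ∀ j : Fin 3, P j.succ - P 0 = ∑ i, M i j • (A i.succ - A 0)) :
    volume (convexHull ℝ ({P 0, P 1, P 2, P 3} : Set (EuclideanSpace ℝ (Fin 3)))) =
      ENNReal.ofReal |M.det| *
        volume (convexHull ℝ ({A 0, A 1, A 2, A 3} : Set (EuclideanSpace ℝ (Fin 3)))) := by
  have hli : LinearIndependent ℝ fun i : Fin 3 => A i.succ - A 0 :=
    ((affineIndependent_iff_linearIndependent_vsub ℝ A 0).1 hA).comp
      (fun i : Fin 3 => (⟨i.succ, i.succ_ne_zero⟩ : {j : Fin 4 // j ≠ 0}))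
      fun i j hij => Fin.succ_injective _ (Subtype.ext_iff.1 hij)
  let b := basisOfLinearIndependentOfCardEqFinrank hli (by simp)
  have hb : ∀ i, b i = A i.succ - A 0 := by simp [b]
  have hf : ∀ j : Fin 3, Matrix.toLin b b M (A j.succ - A 0) = P j.succ - P 0 := fun j => by
    rw [← hb, Matrix.toLin_self, hP]
    simp_rw [hb]
  have h0 : Matrix.toLin b b M (A 1 - A 0) = P 1 - P 0 := hf 0
  have h1 : Matrix.toLin b b M (A 2 - A 0) = P 2 - P 0 := hf 1
  have h2 : Matrix.toLin b b M (A 3 - A 0) = P 3 - P 0 := hf 2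
  rw [volume_convexHull_eq_volume_convexHull_sub (P 0),
    volume_convexHull_eq_volume_convexHull_sub (A 0), ← LinearMap.det_toLin b M,
    ← Measure.addHaar_image_linearMap, LinearMap.image_convexHull]
  simp only [Set.image_insert_eq, Set.image_singleton, map_zero, h0, h1, h2]

/-- **Routh's theorem for tetrahedra, first part.** The volume of the tetrahedron
`P₁P₂P₃P₄` equals `|1 - x₁x₂x₃x₄| / ((1+x₁)(1+x₂)(1+x₃)(1+x₄))` times the volume of the
tetrahedron `A₁A₂A₃A₄`. -/
theorem routh_tetrahedron_first_part
    (A₁ A₂ A₃ A₄ P₁ P₂ P₃ P₄ : EuclideanSpace ℝ (Fin 3))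
    (x₁ x₂ x₃ x₄ : ℝ) (hx₁ : 0 < x₁) (hx₂ : 0 < x₂) (hx₃ : 0 < x₃) (hx₄ : 0 < x₄)
    (hA : AffineIndependent ℝ ![A₁, A₂, A₃, A₄])
    (hP₁ : P₁ ∈ segment ℝ A₁ A₂) (hP₁r : dist A₁ P₁ = x₁ * dist P₁ A₂)
    (hP₂ : P₂ ∈ segment ℝ A₂ A₃) (hP₂r : dist A₂ P₂ = x₂ * dist P₂ A₃)
    (hP₃ : P₃ ∈ segment ℝ A₃ A₄) (hP₃r : dist A₃ P₃ = x₃ * dist P₃ A₄)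
    (hP₄ : P₄ ∈ segment ℝ A₄ A₁) (hP₄r : dist A₄ P₄ = x₄ * dist P₄ A₁) :
    volume (convexHull ℝ ({P₁, P₂, P₃, P₄} : Set (EuclideanSpace ℝ (Fin 3)))) =
      ENNReal.ofReal (|1 - x₁ * x₂ * x₃ * x₄| /
          ((1 + x₁) * (1 + x₂) * (1 + x₃) * (1 + x₄))) *
        volume (convexHull ℝ ({A₁, A₂, A₃, A₄} : Set (EuclideanSpace ℝ (Fin 3)))) := by
  have h₁ := eq_smul_of_mem_segment_of_dist_eq hx₁
    (hA.injective.ne (show (0 : Fin 4) ≠ 1 by decide)) hP₁ hP₁r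
  have h₂ := eq_smul_of_mem_segment_of_dist_eq hx₂
    (hA.injective.ne (show (1 : Fin 4) ≠ 2 by decide)) hP₂ hP₂r
  have h₃ := eq_smul_of_mem_segment_of_dist_eq hx₃
    (hA.injective.ne (show (2 : Fin 4) ≠ 3 by decide)) hP₃ hP₃r
  have h₄ := eq_smul_of_mem_segment_of_dist_eq hx₄
    (hA.injective.ne (show (3 : Fin 4) ≠ 0 by decide)) hP₄ hP₄r
  let M : Matrix (Fin 3) (Fin 3) ℝ :=
    !![1 - x₂ / (1 + x₂) - x₁ / (1 + x₁), -(x₁ / (1 + x₁)), -(x₁ / (1 + x₁));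
      x₂ / (1 + x₂), 1 - x₃ / (1 + x₃), 0;
      0, x₃ / (1 + x₃), 1 - x₄ / (1 + x₄)]
  have hdet : M.det = (1 - x₁ * x₂ * x₃ * x₄) /
      ((1 + x₁) * (1 + x₂) * (1 + x₃) * (1 + x₄)) := by
    simp [M, Matrix.det_fin_three]
    field_simp
    ring
  have key := volume_convexHull_eq_abs_det_mul ![A₁, A₂, A₃, A₄] ![P₁, P₂, P₃, P₄] hA M ?_
  · rwa [hdet, abs_div, abs_of_pos (show 0 < (1 + x₁) * (1 + x₂) * (1 + x₃) * (1 + x₄) by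
      positivity)] at key
  · intro j
    fin_cases j <;> simp [Fin.sum_univ_three, M, h₁, h₂, h₃, h₄] <;> module
end

section
/- Routh's theorem for tetrahedra, second part: Assume x1x2x3x4 > 1. Then the volume of the intersection T ∩ S1 ∩ S2 ∩ S3 ∩ S4 (the middle tetrahedron R1R2R3R4 enclosed by the four cutting planes) equals (x1x2x3x4 − 1)³ / [(1+x1+x1x2+x1x2x3)(1+x2+x2x3+x2x3x4)(1+x3+x3x4+x3x4x1)(1+x4+x4x1+x4x1x2)] times the volume of T. -/
open MeasureTheory

/-- The closed half-space bounded by the hyperplane spanned by the set `s` and containing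
the point `A`: all points `P` such that every affine functional vanishing on `s` which is
nonnegative at `A` is also nonnegative at `P`. -/
def closedHalfspace {V : Type*} [NormedAddCommGroup V] [NormedSpace ℝ V]
    (s : Set V) (A : V) : Set V :=
  {P | ∀ f : V →ᵃ[ℝ] ℝ, (∀ Q ∈ s, f Q = 0) → 0 ≤ f A → 0 ≤ f P}

/-- A point dividing a nondegenerate segment in the ratio `x` is the corresponding weighted mean
of the endpoints, under any affine functional. -/
lemma AffineMap.apply_of_mem_segment_of_dist_eq {V : Type*} [NormedAddCommGroup V]
    [NormedSpace ℝ V] {A B P : V} {x : ℝ} (hAB : A ≠ B) (hP : P ∈ segment ℝ A B)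
    (hr : dist A P = x * dist P B) (f : V →ᵃ[ℝ] ℝ) :
    (1 + x) * f P = f A + x * f B := by
  rw [segment_eq_image_lineMap] at hP
  obtain ⟨t, ⟨ht0, ht1⟩, rfl⟩ := hP
  rw [dist_left_lineMap, dist_lineMap_right, Real.norm_of_nonneg ht0,
    Real.norm_of_nonneg (sub_nonneg.2 ht1), ← mul_assoc] at hr
  have ht : t = x * (1 - t) := mul_right_cancel₀ (dist_ne_zero.2 hAB) hr
  rw [AffineMap.apply_lineMap, AffineMap.lineMap_apply_ring']
  linear_combination (f B - f A) * ht

/-- The half-space bounded by the plane through two vertices of a tetrahedron and a point of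
the opposite edge, in barycentric coordinates. -/
lemma closedHalfspace_eq_setOf_coord_le {V : Type*} [NormedAddCommGroup V] [NormedSpace ℝ V]
    (b : AffineBasis (Fin 4) ℝ V) {i j k l : Fin 4} (hij : i ≠ j) (hik : i ≠ k) (hil : i ≠ l)
    (hjk : j ≠ k) (hjl : j ≠ l) (hkl : k ≠ l) {x : ℝ} (hx : 0 < x) {P : V}
    (hP : P ∈ segment ℝ (b i) (b j)) (hr : dist (b i) P = x * dist P (b j)) :
    closedHalfspace ({b k, b l, P} : Set V) (b i) = {Q | b.coord j Q ≤ x * b.coord i Q} := by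
  have hf (f : V →ᵃ[ℝ] ℝ) : (1 + x) * f P = f (b i) + x * f (b j) :=
    f.apply_of_mem_segment_of_dist_eq (b.ind.injective.ne hij) hP hr
  ext Q
  constructor
  · intro hQ
    have hg := hQ (x • b.coord i - b.coord j)
    have hPi := hf (b.coord i)
    have hPj := hf (b.coord j)
    simp only [b.coord_apply_eq, b.coord_apply_ne hij, b.coord_apply_ne hij.symm] at hPi hPj
    have hP0 : x * b.coord i P - b.coord j P = 0 := by
      have : (1 + x) * (x * b.coord i P - b.coord j P) = 0 := by
        linear_combination x * hPi - hPj
      exact (mul_eq_zero.1 this).resolve_left (by positivity)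
    simpa [b.coord_apply_ne, hij, hik, hil, hjk, hjl, hij.symm, hP0, hx.le] using hg
  · intro hQ f hs hi
    have hk : f (b k) = 0 := hs _ (by simp)
    have hl : f (b l) = 0 := hs _ (by simp)
    have hP0 : f P = 0 := hs _ (by simp)
    have hfQ : f Q = b.coord i Q * f (b i) + b.coord j Q * f (b j) := by
      have huniv : (Finset.univ : Finset (Fin 4)) = {i, j, k, l} := by
        clear * - hij hik hil hjk hjl hkl
        decide +revert
      conv_lhs => rw [← b.affineCombination_coord_eq_self Q]
      rw [Finset.map_affineCombination _ _ _ (b.sum_coord_apply_eq_one Q),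
        Finset.affineCombination_eq_linear_combination _ _ _ (b.sum_coord_apply_eq_one Q), huniv]
      simp [Finset.sum_insert, hij, hik, hil, hjk, hjl, hkl, hk, hl]
    have h := hf f
    rw [hP0, mul_zero] at h
    have hj : f (b j) ≤ 0 := by
      by_contra! hj
      nlinarith [mul_pos hx hj]
    have hQ' : b.coord j Q ≤ x * b.coord i Q := hQ
    have hfQ' : f Q = -f (b j) * (x * b.coord i Q - b.coord j Q) := by
      linear_combination hfQ - b.coord i Q * h
    rw [hfQ']
    exact mul_nonneg (neg_nonneg.2 hj) (sub_nonneg.2 hQ')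

/-- A self-map of a finite-dimensional space given by an affine formula in the first three
barycentric coordinates scales the measure of preimages by the inverse determinant. -/
lemma AffineBasis.exists_addHaar_preimage_eq {V : Type*} [NormedAddCommGroup V]
    [NormedSpace ℝ V] [FiniteDimensional ℝ V] [MeasurableSpace V] [BorelSpace V]
    (μ : Measure V) [μ.IsAddHaarMeasure] (b : AffineBasis (Fin 4) ℝ V)
    (M : Matrix (Fin 3) (Fin 3) ℝ) (hM : M.det ≠ 0) (u : Fin 3 → ℝ) :
    ∃ h : V → V,
      (∀ Q i, b.coord (Fin.castSucc i) (h Q) =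
        ∑ j, M i j * b.coord (Fin.castSucc j) Q + u i) ∧
      ∀ s : Set V, μ (h ⁻¹' s) = ENNReal.ofReal |M.det⁻¹| * μ s := by
  let B : Module.Basis (Fin 3) ℝ V :=
    (b.basisOf (Fin.last 3)).reindex (finSuccAboveEquiv (Fin.last 3)).symm
  have hB (j : Fin 3) : B j = b (Fin.castSucc j) - b (Fin.last 3) := by
    simp [B, AffineBasis.basisOf_apply, -Fin.reduceLast, finSuccAboveEquiv_apply]
  have hlin (i : Fin 3) : (b.coord (Fin.castSucc i)).linear = B.coord i := by
    refine B.ext fun j => ?_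
    have hlast : b.coord (Fin.castSucc i) (b (Fin.last 3)) = 0 :=
      b.coord_apply_ne (Fin.castSucc_lt_last i).ne
    rw [Module.Basis.coord_apply, B.repr_self, hB j, ← vsub_eq_sub, AffineMap.linearMap_vsub, hlast]
    simp [b.coord_apply, Finsupp.single_apply, eq_comm]
  have hcoord (i : Fin 3) (Q : V) :
      b.coord (Fin.castSucc i) Q = B.repr (Q - b (Fin.last 3)) i := by
    have := (b.coord (Fin.castSucc i)).linearMap_vsub Q (b (Fin.last 3))
    rw [hlin, b.coord_apply_ne (Fin.castSucc_lt_last i).ne, vsub_eq_sub, vsub_eq_sub,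
      sub_zero] at this
    exact this.symm
  let L := Matrix.toLin B B M
  let w : V := B.equivFun.symm u
  refine ⟨fun Q => L Q + (w + b (Fin.last 3) - L (b (Fin.last 3))), fun Q i => ?_, fun s => ?_⟩
  · have : L Q + (w + b (Fin.last 3) - L (b (Fin.last 3))) - b (Fin.last 3) =
        L (Q - b (Fin.last 3)) + w := by
      rw [map_sub]; abel
    simp only [hcoord, this, map_add, Finsupp.add_apply]
    congr 1
    · have := congrFun (LinearMap.toMatrix_mulVec_repr B B L (Q - b (Fin.last 3))) i
      rw [LinearMap.toMatrix_toLin] at this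
      exact this.symm
    · exact congrFun (B.equivFun.apply_symm_apply u) i
  · have hdet : LinearMap.det L = M.det := LinearMap.det_toLin B M
    have := Measure.addHaar_preimage_linearMap μ (f := L) (by rwa [hdet])
      ((fun y => y + (w + b (Fin.last 3) - L (b (Fin.last 3)))) ⁻¹' s)
    rw [hdet, measure_preimage_add_right] at this
    exact this

/-- **Routh's theorem for tetrahedra, second part.** If `x₁x₂x₃x₄ > 1`, the middle
tetrahedron enclosed by the four cutting planes has volume
`(x₁x₂x₃x₄-1)³ / ((1+x₁+x₁x₂+x₁x₂x₃)(1+x₂+x₂x₃+x₂x₃x₄)(1+x₃+x₃x₄+x₃x₄x₁)(1+x₄+x₄x₁+x₄x₁x₂))`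
times the volume of the tetrahedron `A₁A₂A₃A₄`. -/
theorem routh_tetrahedron_second_part
    (A₁ A₂ A₃ A₄ P₁ P₂ P₃ P₄ : EuclideanSpace ℝ (Fin 3))
    (x₁ x₂ x₃ x₄ : ℝ) (hx₁ : 0 < x₁) (hx₂ : 0 < x₂) (hx₃ : 0 < x₃) (hx₄ : 0 < x₄)
    (hA : AffineIndependent ℝ ![A₁, A₂, A₃, A₄])
    (hP₁ : P₁ ∈ segment ℝ A₁ A₂) (hP₁r : dist A₁ P₁ = x₁ * dist P₁ A₂)
    (hP₂ : P₂ ∈ segment ℝ A₂ A₃) (hP₂r : dist A₂ P₂ = x₂ * dist P₂ A₃)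
    (hP₃ : P₃ ∈ segment ℝ A₃ A₄) (hP₃r : dist A₃ P₃ = x₃ * dist P₃ A₄)
    (hP₄ : P₄ ∈ segment ℝ A₄ A₁) (hP₄r : dist A₄ P₄ = x₄ * dist P₄ A₁)
    (hprod : 1 < x₁ * x₂ * x₃ * x₄) :
    volume (convexHull ℝ ({A₁, A₂, A₃, A₄} : Set (EuclideanSpace ℝ (Fin 3))) ∩
        closedHalfspace ({A₃, A₄, P₁} : Set (EuclideanSpace ℝ (Fin 3))) A₁ ∩
        closedHalfspace ({A₄, A₁, P₂} : Set (EuclideanSpace ℝ (Fin 3))) A₂ ∩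
        closedHalfspace ({A₁, A₂, P₃} : Set (EuclideanSpace ℝ (Fin 3))) A₃ ∩
        closedHalfspace ({A₂, A₃, P₄} : Set (EuclideanSpace ℝ (Fin 3))) A₄) =
      ENNReal.ofReal ((x₁ * x₂ * x₃ * x₄ - 1) ^ 3 /
          ((1 + x₁ + x₁ * x₂ + x₁ * x₂ * x₃) * (1 + x₂ + x₂ * x₃ + x₂ * x₃ * x₄) *
            (1 + x₃ + x₃ * x₄ + x₃ * x₄ * x₁) * (1 + x₄ + x₄ * x₁ + x₄ * x₁ * x₂))) *
        volume (convexHull ℝ ({A₁, A₂, A₃, A₄} : Set (EuclideanSpace ℝ (Fin 3)))) := by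
  have hspan : affineSpan ℝ (Set.range ![A₁, A₂, A₃, A₄]) = ⊤ := by
    rw [hA.affineSpan_eq_top_iff_card_eq_finrank_add_one]
    simp
  let b : AffineBasis (Fin 4) ℝ (EuclideanSpace ℝ (Fin 3)) := ⟨![A₁, A₂, A₃, A₄], hA, hspan⟩
  have hT : convexHull ℝ ({A₁, A₂, A₃, A₄} : Set (EuclideanSpace ℝ (Fin 3))) =
      {Q | ∀ i, 0 ≤ b.coord i Q} := by
    rw [← b.convexHull_eq_nonneg_coord]
    congr 1
    ext Q
    change _ ↔ Q ∈ Set.range ![A₁, A₂, A₃, A₄]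
    simp [Matrix.range_cons, Matrix.range_empty]
    tauto
  have h₁ : closedHalfspace ({A₃, A₄, P₁} : Set (EuclideanSpace ℝ (Fin 3))) A₁ = _ :=
    closedHalfspace_eq_setOf_coord_le b (i := 0) (j := 1) (k := 2) (l := 3) (by decide)
      (by decide) (by decide) (by decide) (by decide) (by decide) hx₁ hP₁ hP₁r
  have h₂ : closedHalfspace ({A₄, A₁, P₂} : Set (EuclideanSpace ℝ (Fin 3))) A₂ = _ :=
    closedHalfspace_eq_setOf_coord_le b (i := 1) (j := 2) (k := 3) (l := 0) (by decide)
      (by decide) (by decide) (by decide) (by decide) (by decide) hx₂ hP₂ hP₂r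
  have h₃ : closedHalfspace ({A₁, A₂, P₃} : Set (EuclideanSpace ℝ (Fin 3))) A₃ = _ :=
    closedHalfspace_eq_setOf_coord_le b (i := 2) (j := 3) (k := 0) (l := 1) (by decide)
      (by decide) (by decide) (by decide) (by decide) (by decide) hx₃ hP₃ hP₃r
  have h₄ : closedHalfspace ({A₂, A₃, P₄} : Set (EuclideanSpace ℝ (Fin 3))) A₄ = _ :=
    closedHalfspace_eq_setOf_coord_le b (i := 3) (j := 0) (k := 1) (l := 2) (by decide)
      (by decide) (by decide) (by decide) (by decide) (by decide) hx₄ hP₄ hP₄r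
  set D₁ := 1 + x₁ + x₁ * x₂ + x₁ * x₂ * x₃ with hD₁
  set D₂ := 1 + x₂ + x₂ * x₃ + x₂ * x₃ * x₄ with hD₂
  set D₃ := 1 + x₃ + x₃ * x₄ + x₃ * x₄ * x₁ with hD₃
  set D₄ := 1 + x₄ + x₄ * x₁ + x₄ * x₁ * x₂ with hD₄
  have hD₁pos : 0 < D₁ := by positivity
  have hD₂pos : 0 < D₂ := by positivity
  have hD₃pos : 0 < D₃ := by positivity
  have hD₄pos : 0 < D₄ := by positivity
  set q := x₁ * x₂ * x₃ * x₄ - 1 with hq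
  have hqpos : 0 < q := by linarith
  let M : Matrix (Fin 3) (Fin 3) ℝ :=
    !![D₂ / q * x₁, -(D₂ / q), 0;
      0, D₃ / q * x₂, -(D₃ / q);
      D₄ / q, D₄ / q, D₄ / q * (x₃ + 1)]
  have hMdet : M.det = D₁ * D₂ * D₃ * D₄ / q ^ 3 := by
    simp only [M, Matrix.det_fin_three]
    simp
    field_simp
    rw [hD₁]
    ring
  obtain ⟨h, hh, hvol⟩ := b.exists_addHaar_preimage_eq volume M
    (by rw [hMdet]; positivity) ![0, 0, -(D₄ / q)]
  have key : convexHull ℝ ({A₁, A₂, A₃, A₄} : Set (EuclideanSpace ℝ (Fin 3))) ∩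
        closedHalfspace ({A₃, A₄, P₁} : Set (EuclideanSpace ℝ (Fin 3))) A₁ ∩
        closedHalfspace ({A₄, A₁, P₂} : Set (EuclideanSpace ℝ (Fin 3))) A₂ ∩
        closedHalfspace ({A₁, A₂, P₃} : Set (EuclideanSpace ℝ (Fin 3))) A₃ ∩
        closedHalfspace ({A₂, A₃, P₄} : Set (EuclideanSpace ℝ (Fin 3))) A₄ =
      h ⁻¹' convexHull ℝ ({A₁, A₂, A₃, A₄} : Set (EuclideanSpace ℝ (Fin 3))) := by
    rw [h₁, h₂, h₃, h₄, hT]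
    ext Q
    have hsum := b.sum_coord_apply_eq_one Q
    have hsum' := b.sum_coord_apply_eq_one (h Q)
    rw [Fin.sum_univ_four] at hsum hsum'
    have e₁ : b.coord 0 (h Q) = D₂ / q * (x₁ * b.coord 0 Q - b.coord 1 Q) := by
      refine (hh Q 0).trans ?_
      simp [Fin.sum_univ_three, M]
      ring
    have e₂ : b.coord 1 (h Q) = D₃ / q * (x₂ * b.coord 1 Q - b.coord 2 Q) := by
      refine (hh Q 1).trans ?_
      simp [Fin.sum_univ_three, M]
      ring
    have e₃ : b.coord 2 (h Q) = D₄ / q * (x₃ * b.coord 2 Q - b.coord 3 Q) := by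
      refine (hh Q 2).trans ?_
      simp [Fin.sum_univ_three, M]
      linear_combination (D₄ / q) * hsum
    have e₄ : b.coord 3 (h Q) = D₁ / q * (x₄ * b.coord 3 Q - b.coord 0 Q) := by
      have hsplit : b.coord 3 (h Q) = b.coord 0 Q + b.coord 1 Q + b.coord 2 Q + b.coord 3 Q -
          b.coord 0 (h Q) - b.coord 1 (h Q) - b.coord 2 (h Q) := by
        linear_combination hsum' - hsum
      rw [hsplit, e₁, e₂, e₃]
      field_simp
      simp only [hq, hD₁, hD₂, hD₃, hD₄]
      ring
    simp only [Set.mem_inter_iff, Set.mem_ofPred_eq, Set.mem_preimage]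
    have hall (a : Fin 4 → ℝ) : (∀ i, 0 ≤ a i) ↔ 0 ≤ a 0 ∧ 0 ≤ a 1 ∧ 0 ≤ a 2 ∧ 0 ≤ a 3 := by
      simp [Fin.forall_fin_succ]
    rw [hall fun i => b.coord i Q, hall fun i => b.coord i (h Q), e₁, e₂, e₃, e₄,
      mul_nonneg_iff_of_pos_left (by positivity), mul_nonneg_iff_of_pos_left (by positivity),
      mul_nonneg_iff_of_pos_left (by positivity), mul_nonneg_iff_of_pos_left (by positivity),
      sub_nonneg, sub_nonneg, sub_nonneg, sub_nonneg]
    refine ⟨fun ⟨⟨⟨⟨_, i₁⟩, i₂⟩, i₃⟩, i₄⟩ => ⟨i₁, i₂, i₃, i₄⟩,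
      fun ⟨i₁, i₂, i₃, i₄⟩ => ⟨⟨⟨⟨?_, i₁⟩, i₂⟩, i₃⟩, i₄⟩⟩
    have n₁ : 0 ≤ b.coord 0 Q := by
      refine nonneg_of_mul_nonneg_right (a := q) ?_ hqpos
      have j₂ := mul_le_mul_of_nonneg_left i₃ hx₄.le
      have j₃ := mul_le_mul_of_nonneg_left i₂ (mul_pos hx₄ hx₃).le
      have j₄ := mul_le_mul_of_nonneg_left i₁ (mul_pos (mul_pos hx₄ hx₃) hx₂).le
      rw [hq]
      linarith
    have n₄ : 0 ≤ b.coord 3 Q := nonneg_of_mul_nonneg_right (n₁.trans i₄) hx₄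
    have n₃ : 0 ≤ b.coord 2 Q := nonneg_of_mul_nonneg_right (n₄.trans i₃) hx₃
    have n₂ : 0 ≤ b.coord 1 Q := nonneg_of_mul_nonneg_right (n₃.trans i₂) hx₂
    exact ⟨n₁, n₂, n₃, n₄⟩
  rw [key, hvol, hMdet]
  congr 2
  rw [abs_of_nonneg (by positivity)]
  field_simp
end

section
/- The volume of the tetrahedron A1P1Q1A4 equals x1²x2 / ((1+x1)(1+x1+x1x2)) times the volume of the tetrahedron A1A2A3A4. -/
open MeasureTheory

/-- A point dividing a nondegenerate segment in the ratio `x : 1`. -/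
lemma sub_eq_smul_of_mem_segment_of_dist_eq {E : Type*} [NormedAddCommGroup E] [NormedSpace ℝ E]
    {A B P : E} {x : ℝ} (hx : 0 < x) (hAB : A ≠ B) (hP : P ∈ segment ℝ A B)
    (hr : dist A P = x * dist P B) : P - A = (x / (1 + x)) • (B - A) := by
  rw [segment_eq_image_lineMap] at hP
  obtain ⟨θ, ⟨h0, h1⟩, rfl⟩ := hP
  rw [dist_left_lineMap, dist_lineMap_right, Real.norm_of_nonneg h0,
    Real.norm_of_nonneg (sub_nonneg.2 h1), ← mul_assoc] at hr
  have hθ := mul_right_cancel₀ (dist_ne_zero.2 hAB) hr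
  have : θ = x / (1 + x) := by
    rw [eq_div_iff (by positivity)]
    linarith
  rw [← this, AffineMap.lineMap_apply_module']
  abel

/-- An affine map rescales the volume of convex hulls by the determinant of its linear part. -/
lemma volume_convexHull_image_affineMap {E : Type*} [NormedAddCommGroup E] [InnerProductSpace ℝ E]
    [FiniteDimensional ℝ E] [MeasurableSpace E] [BorelSpace E] (T : E →ᵃ[ℝ] E) (s : Set E) :
    volume (convexHull ℝ (T '' s)) =
      ENNReal.ofReal |LinearMap.det T.linear| * volume (convexHull ℝ s) := by
  have hT : (T : E → E) = (fun y => y + T 0) ∘ T.linear := T.decomp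
  rw [← T.image_convexHull, hT, Set.image_comp, Set.image_add_right, measure_preimage_add_right,
    Measure.addHaar_image_linearMap]

/-- The edge vectors of a nondegenerate tetrahedron at its first vertex are linearly independent. -/
lemma AffineIndependent.linearIndependent_edges {E : Type*} [AddCommGroup E] [Module ℝ E]
    {A₁ A₂ A₃ A₄ : E} (hA : AffineIndependent ℝ ![A₁, A₂, A₃, A₄]) :
    LinearIndependent ℝ ![A₂ - A₁, A₃ - A₁, A₄ - A₁] := by
  rw [affineIndependent_iff_linearIndependent_vsub ℝ _ 0] at hA
  have h := hA.comp _ (finSuccAboveEquiv (0 : Fin 4)).injective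
  have hfun : (fun i : {i : Fin 4 // i ≠ 0} => ![A₁, A₂, A₃, A₄] i -ᵥ ![A₁, A₂, A₃, A₄] 0) ∘
      finSuccAboveEquiv (0 : Fin 4) = ![A₂ - A₁, A₃ - A₁, A₄ - A₁] := by
    ext i
    fin_cases i <;> rfl
  rwa [← hfun]

/-- The intersection point of the cevians `P₁A₃` and `A₁P₂` of the triangle `A₁A₂A₃`. -/
lemma cevian_intersection {E : Type*} [AddCommGroup E] [Module ℝ E]
    {A₁ A₂ A₃ P₁ P₂ Q : E} {x₁ x₂ : ℝ} (hx₁ : 0 < x₁) (hx₂ : 0 < x₂)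
    (hli : LinearIndependent ℝ ![A₂ - A₁, A₃ - A₁])
    (hP₁ : P₁ - A₁ = (x₁ / (1 + x₁)) • (A₂ - A₁))
    (hP₂ : P₂ - A₂ = (x₂ / (1 + x₂)) • (A₃ - A₂))
    (hQ : Q ∈ affineSpan ℝ ({P₁, A₃} : Set E)) (hQ' : Q ∈ affineSpan ℝ ({A₁, P₂} : Set E)) :
    Q - A₁ = (x₁ / (1 + x₁ + x₁ * x₂)) • (A₂ - A₁) +
      (x₁ * x₂ / (1 + x₁ + x₁ * x₂)) • (A₃ - A₁) := by
  obtain ⟨s, rfl⟩ := mem_affineSpan_pair_iff_exists_lineMap_eq.1 hQ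
  obtain ⟨t, ht⟩ := mem_affineSpan_pair_iff_exists_lineMap_eq.1 hQ'
  rw [AffineMap.lineMap_apply_module', AffineMap.lineMap_apply_module'] at ht
  rw [AffineMap.lineMap_apply_module']
  obtain rfl := eq_add_of_sub_eq hP₁
  obtain rfl := eq_add_of_sub_eq hP₂
  have hcomb : (t * (1 - x₂ / (1 + x₂)) - (1 - s) * (x₁ / (1 + x₁))) • (A₂ - A₁) +
      (t * (x₂ / (1 + x₂)) - s) • (A₃ - A₁) = 0 := by
    rw [← sub_eq_zero] at ht
    rw [← ht]
    module
  obtain ⟨h1, h2⟩ := LinearIndependent.pair_iff.1 hli _ _ hcomb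
  have hs : s = x₁ * x₂ / (1 + x₁ + x₁ * x₂) := by
    field_simp at h1 h2 ⊢
    have h3 : t = (1 - s) * x₁ * (1 + x₂) / (1 + x₁) := by
      field_simp
      linarith
    have h4 : t * x₂ = s * (1 + x₂) := by linarith
    rw [h3] at h4
    field_simp at h4
    linarith
  have hs' : (1 - s) * (x₁ / (1 + x₁)) = x₁ / (1 + x₁ + x₁ * x₂) := by
    rw [hs]
    field_simp
    ring
  rw [← hs, ← hs']
  module

/-- The volume of the tetrahedron `A₁P₁Q₁A₄` equals `x₁²x₂ / ((1+x₁)(1+x₁+x₁x₂))` times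
the volume of the tetrahedron `A₁A₂A₃A₄`, where `Q₁` is the intersection point of the
lines `P₁A₃` and `A₁P₂`. -/
theorem routh_tetrahedron_double_cut
    (A₁ A₂ A₃ A₄ P₁ P₂ Q₁ : EuclideanSpace ℝ (Fin 3))
    (x₁ x₂ : ℝ) (hx₁ : 0 < x₁) (hx₂ : 0 < x₂)
    (hA : AffineIndependent ℝ ![A₁, A₂, A₃, A₄])
    (hP₁ : P₁ ∈ segment ℝ A₁ A₂) (hP₁r : dist A₁ P₁ = x₁ * dist P₁ A₂)
    (hP₂ : P₂ ∈ segment ℝ A₂ A₃) (hP₂r : dist A₂ P₂ = x₂ * dist P₂ A₃)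
    (hQ₁ : Q₁ ∈ affineSpan ℝ ({P₁, A₃} : Set (EuclideanSpace ℝ (Fin 3))))
    (hQ₁' : Q₁ ∈ affineSpan ℝ ({A₁, P₂} : Set (EuclideanSpace ℝ (Fin 3)))) :
    volume (convexHull ℝ ({A₁, P₁, Q₁, A₄} : Set (EuclideanSpace ℝ (Fin 3)))) =
      ENNReal.ofReal (x₁ ^ 2 * x₂ / ((1 + x₁) * (1 + x₁ + x₁ * x₂))) *
        volume (convexHull ℝ ({A₁, A₂, A₃, A₄} : Set (EuclideanSpace ℝ (Fin 3)))) := by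
  have h12 : A₁ ≠ A₂ := hA.injective.ne (show (0 : Fin 4) ≠ 1 by decide)
  have h23 : A₂ ≠ A₃ := hA.injective.ne (show (1 : Fin 4) ≠ 2 by decide)
  have hli := hA.linearIndependent_edges
  have hli₂ : LinearIndependent ℝ ![A₂ - A₁, A₃ - A₁] := by
    convert hli.comp _ (Fin.castSucc_injective 2) using 1
    ext i
    fin_cases i <;> rfl
  have hP := sub_eq_smul_of_mem_segment_of_dist_eq hx₁ h12 hP₁ hP₁r
  have hQ := cevian_intersection hx₁ hx₂ hli₂ hP
    (sub_eq_smul_of_mem_segment_of_dist_eq hx₂ h23 hP₂ hP₂r) hQ₁ hQ₁'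
  let b := basisOfLinearIndependentOfCardEqFinrank hli (by simp)
  have hb : ⇑b = ![A₂ - A₁, A₃ - A₁, A₄ - A₁] :=
    coe_basisOfLinearIndependentOfCardEqFinrank hli _
  let M : Matrix (Fin 3) (Fin 3) ℝ :=
    !![x₁ / (1 + x₁), x₁ / (1 + x₁ + x₁ * x₂), 0;
      0, x₁ * x₂ / (1 + x₁ + x₁ * x₂), 0;
      0, 0, 1]
  let f := Matrix.toLin b b M
  have hf₂ : f (A₂ - A₁) = P₁ - A₁ := by
    have := Matrix.toLin_self b b M 0
    simpa [hb, M, Fin.sum_univ_three, ← hP] using this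
  have hf₃ : f (A₃ - A₁) = Q₁ - A₁ := by
    have := Matrix.toLin_self b b M 1
    simpa [hb, M, Fin.sum_univ_three, ← hQ] using this
  have hf₄ : f (A₄ - A₁) = A₄ - A₁ := by
    have := Matrix.toLin_self b b M 2
    simpa [hb, M, Fin.sum_univ_three] using this
  let T : EuclideanSpace ℝ (Fin 3) →ᵃ[ℝ] EuclideanSpace ℝ (Fin 3) :=
    AffineMap.mk' (fun y => f (y - A₁) + A₁) f A₁ (by simp)
  have hT : ∀ y, T y = f (y - A₁) + A₁ := fun _ => rfl
  have hdet : LinearMap.det T.linear = x₁ ^ 2 * x₂ / ((1 + x₁) * (1 + x₁ + x₁ * x₂)) := by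
    change LinearMap.det (Matrix.toLin b b M) = _
    rw [LinearMap.det_toLin, Matrix.det_fin_three]
    simp [M]
    field_simp
  have himage : ({A₁, P₁, Q₁, A₄} : Set (EuclideanSpace ℝ (Fin 3))) = T '' {A₁, A₂, A₃, A₄} := by
    simp [Set.image_insert_eq, hT, -map_sub, hf₂, hf₃, hf₄]
  rw [himage, volume_convexHull_image_affineMap, hdet, abs_of_pos (by positivity)]
end

section
/- Let B = {k, k+1, …, k+l} (indices mod n) be a set of consecutive indices with l + 1 ≤ n − 1. Then the intersection ∩_{i∈B} T_i is the convex hull of the points A^0_k, A^1_k, …, A^{l+1}_k, A^0_{k+l+2}, …, A^0_{k+n−1}, and its volume equals V(B) times the volume of S, where V(B) = ∏_{j=k}^{k+l} (∏_{a=k}^{j} x_a) / (1 + Σ_{b=k}^{j} ∏_{a=k}^{b} x_a). -/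
open MeasureTheory Finset

/-- `T_i = H_i ∩ S`, where `H_i` is the closed half-space bounded by the hyperplane `σ_i`
through `A^0_1, …, A^0_{i-1}, A^1_i, A^0_{i+2}, …, A^0_n` containing `A^0_i`, and `S` is
the simplex `A^0_1 … A^0_n`. -/
def routhPiece {n : ℕ} [NeZero n] (A : ℕ → ZMod n → EuclideanSpace ℝ (Fin (n - 1)))
    (i : ZMod n) : Set (EuclideanSpace ℝ (Fin (n - 1))) :=
  closedHalfspace ({A 1 i} ∪ (A 0) '' {m | m ≠ i ∧ m ≠ i + 1}) (A 0 i) ∩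
    convexHull ℝ (Set.range (A 0))

/-- `V(B)` for a block `B = {k, k+1, …, k+l}` of consecutive indices mod `n`:
`V(B) = ∏_{j=k}^{k+l} (∏_{a=k}^{j} x_a) / (1 + Σ_{b=k}^{j} ∏_{a=k}^{b} x_a)`. -/
noncomputable def routhBlockValue {n : ℕ} [NeZero n] (x : ZMod n → ℝ) (k : ZMod n)
    (l : ℕ) : ℝ :=
  ∏ j ∈ Finset.range (l + 1),
    (∏ a ∈ Finset.range (j + 1), x (k + (a : ZMod n))) /
      (1 + ∑ b ∈ Finset.range (j + 1), ∏ a ∈ Finset.range (b + 1), x (k + (a : ZMod n)))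

/-- The product `x_i x_{i+1} ⋯ x_{i+m-1}`. -/
noncomputable def routhWeight {n : ℕ} (x : ZMod n → ℝ) (i : ZMod n) (m : ℕ) : ℝ :=
  ∏ a ∈ Finset.range m, x (i + (a : ZMod n))

/-- The sum of the first `j + 1` of the products `routhWeight x i m`. -/
noncomputable def routhWeightSum {n : ℕ} (x : ZMod n → ℝ) (i : ZMod n) (j : ℕ) : ℝ :=
  ∑ b ∈ Finset.range (j + 1), routhWeight x i b

section Weights

variable {n : ℕ} {x : ZMod n → ℝ}

lemma routhWeight_pos (hx : ∀ i, 0 < x i) (i : ZMod n) (m : ℕ) : 0 < routhWeight x i m :=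
  Finset.prod_pos fun _ _ => hx _

lemma routhWeightSum_pos (hx : ∀ i, 0 < x i) (i : ZMod n) (j : ℕ) :
    0 < routhWeightSum x i j :=
  Finset.sum_pos (fun _ _ => routhWeight_pos hx _ _) ⟨0, by simp⟩

@[simp] lemma routhWeight_zero (i : ZMod n) : routhWeight x i 0 = 1 := by simp [routhWeight]

lemma routhWeight_succ (i : ZMod n) (m : ℕ) :
    routhWeight x i (m + 1) = routhWeight x i m * x (i + (m : ZMod n)) := by
  simp [routhWeight, Finset.prod_range_succ]

lemma routhWeight_succ' (i : ZMod n) (m : ℕ) :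
    routhWeight x i (m + 1) = x i * routhWeight x (i + 1) m := by
  rw [routhWeight, Finset.prod_range_succ', mul_comm, routhWeight]
  simp only [Nat.cast_zero, add_zero, Nat.cast_add, Nat.cast_one]
  congr 1
  refine Finset.prod_congr rfl fun a _ => ?_
  congr 1
  ring

@[simp] lemma routhWeightSum_zero (i : ZMod n) : routhWeightSum x i 0 = 1 := by
  simp [routhWeightSum]

lemma routhWeightSum_succ (i : ZMod n) (j : ℕ) :
    routhWeightSum x i (j + 1) = routhWeightSum x i j + routhWeight x i (j + 1) := by
  simp [routhWeightSum, Finset.sum_range_succ]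

lemma routhBlockValue_eq [NeZero n] (k : ZMod n) (l : ℕ) :
    routhBlockValue x k l =
      ∏ j ∈ Finset.range (l + 1), routhWeight x k (j + 1) / routhWeightSum x k (j + 1) := by
  refine Finset.prod_congr rfl fun j _ => ?_
  rw [routhWeightSum, Finset.sum_range_succ' _ (j + 1), add_comm _ (routhWeight x k 0),
    routhWeight_zero]
  rfl

end Weights

section CyclicIndex

variable {n : ℕ}

lemma ZMod.exists_lt_eq_add_natCast [NeZero n] (k i : ZMod n) : ∃ m < n, i = k + (m : ZMod n) :=
  ⟨(i - k).val, ZMod.val_lt _, by simp⟩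

lemma ZMod.add_natCast_inj {k : ZMod n} {a b : ℕ} (ha : a < n) (hb : b < n) :
    k + (a : ZMod n) = k + (b : ZMod n) ↔ a = b := by
  rw [add_right_inj, ZMod.natCast_eq_natCast_iff', Nat.mod_eq_of_lt ha, Nat.mod_eq_of_lt hb]

lemma ZMod.sum_univ_eq_sum_range_add [NeZero n] {M : Type*} [AddCommMonoid M] (k : ZMod n)
    (f : ZMod n → M) : ∑ i, f i = ∑ m ∈ Finset.range n, f (k + (m : ZMod n)) := by
  symm
  refine Finset.sum_bij (fun m _ => k + (m : ZMod n)) (fun _ _ => Finset.mem_univ _) ?_ ?_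
    fun _ _ => rfl
  · intro a ha b hb h
    exact (ZMod.add_natCast_inj (Finset.mem_range.1 ha) (Finset.mem_range.1 hb)).1 h
  · intro i _
    obtain ⟨m, hm, rfl⟩ := ZMod.exists_lt_eq_add_natCast k i
    exact ⟨m, Finset.mem_range.2 hm, rfl⟩

end CyclicIndex

/-- Summation by parts. -/
lemma Finset.sum_range_sub_smul_sum_range {M : Type*} [AddCommGroup M] [Module ℝ M]
    (u : ℕ → ℝ) (g : ℕ → M) (N : ℕ) :
    ∑ j ∈ Finset.range N, (u j - u (j + 1)) • ∑ b ∈ Finset.range (j + 1), g b =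
      ∑ b ∈ Finset.range N, u b • g b - u N • ∑ b ∈ Finset.range N, g b := by
  induction N with
  | zero => simp
  | succ N ih =>
    rw [Finset.sum_range_succ, ih, Finset.sum_range_succ _ N, Finset.sum_range_succ _ N]
    module

section Coordinates

variable {n : ℕ} {E : Type*} [NormedAddCommGroup E] [NormedSpace ℝ E]
  {A : ℕ → ZMod n → E} {x : ZMod n → ℝ}

lemma eq_lineMap_of_dist_ratio {a b p : E} {r : ℝ} (hr : 0 < r) (hab : a ≠ b)
    (hp : p ∈ segment ℝ a b) (h : dist a p = r * dist p b) :
    p = AffineMap.lineMap a b (r / (1 + r)) := by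
  rw [segment_eq_image_lineMap] at hp
  obtain ⟨t, ⟨h0, h1⟩, rfl⟩ := hp
  rw [dist_left_lineMap, dist_lineMap_right, Real.norm_of_nonneg h0,
    Real.norm_of_nonneg (sub_nonneg.2 h1), ← mul_assoc] at h
  have := mul_right_cancel₀ (dist_ne_zero.2 hab) h
  congr 1
  rw [eq_div_iff (by positivity)]
  linarith

/-- The barycentric coordinates of `A^j_i` with respect to the simplex `A^0`. -/
lemma coord_routh_point (hn : 2 ≤ n) (hx : ∀ i, 0 < x i) (B : AffineBasis (ZMod n) ℝ E)
    (hB : ∀ i, B i = A 0 i)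
    (hone : ∀ i, A 1 i = AffineMap.lineMap (A 0 i) (A 0 (i + 1)) (x i / (1 + x i)))
    (hA : ∀ (i : ZMod n) (j : ℕ), 2 ≤ j → j ≤ n - 1 →
      A j i ∈ affineSpan ℝ ({A (j - 1) i, A 0 (i + (j : ZMod n))} : Set E) ∧
      A j i ∈ affineSpan ℝ ({A (j - 1) (i + 1), A 0 i} : Set E))
    {j : ℕ} (hj : j ≤ n - 1) (i : ZMod n) {m : ℕ} (hm : m < n) :
    B.coord (i + (m : ZMod n)) (A j i) =
      if m ≤ j then routhWeight x i m / routhWeightSum x i j else 0 := by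
  have hzero : ∀ (i : ZMod n) {m m' : ℕ}, m < n → m' < n →
      B.coord (i + (m : ZMod n)) (A 0 (i + (m' : ZMod n))) = if m = m' then 1 else 0 := by
    intro i m m' hm hm'
    simp only [← hB, AffineBasis.coord_apply, ZMod.add_natCast_inj hm hm']
  have hzero' : ∀ (i : ZMod n) {m : ℕ}, m < n →
      B.coord (i + (m : ZMod n)) (A 0 i) = if m = 0 then 1 else 0 := by
    intro i m hm
    simpa using hzero i hm (m' := 0) (by omega)
  induction j generalizing i m with
  | zero => rw [hzero' i hm]; rcases m with _ | m <;> simp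
  | succ j ih =>
    have hxi := hx i
    rcases Nat.eq_zero_or_pos j with rfl | hj0
    · rw [hone, AffineMap.apply_lineMap, hzero' i hm]
      have h1 := hzero i hm (m' := 1) (by omega)
      rw [Nat.cast_one] at h1
      rw [h1, AffineMap.lineMap_apply_module, routhWeightSum_succ]
      have : routhWeight x i 1 = x i := by simp [routhWeight]
      rcases m with _ | _ | m
      · simp [this]; field_simp; ring
      · simp [this]
      · simp
    · obtain ⟨h1, h2⟩ := hA i (j + 1) (by omega) hj
      rw [Nat.add_sub_cancel] at h1 h2
      obtain ⟨t, ht⟩ := mem_affineSpan_pair_iff_exists_lineMap_eq.1 h1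
      obtain ⟨s, hs⟩ := mem_affineSpan_pair_iff_exists_lineMap_eq.1 h2
      have c1 : ∀ m < n, B.coord (i + (m : ZMod n)) (A (j + 1) i) =
          (1 - t) * (if m ≤ j then routhWeight x i m / routhWeightSum x i j else 0)
            + t * (if m = j + 1 then 1 else 0) := by
        intro m hm
        rw [← ht, AffineMap.apply_lineMap, AffineMap.lineMap_apply_module, ih (by omega) i hm,
          hzero i hm (by omega)]
        simp only [smul_eq_mul]
      have c2 : ∀ m, m + 1 < n → B.coord (i + ((m + 1 : ℕ) : ZMod n)) (A (j + 1) i) =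
          (1 - s) * (if m ≤ j then routhWeight x (i + 1) m / routhWeightSum x (i + 1) j
            else 0) := by
        intro m hm
        have hm' := ih (by omega) (i + 1) (m := m) (by omega)
        rw [show i + 1 + (m : ZMod n) = i + ((m + 1 : ℕ) : ZMod n) by push_cast; ring] at hm'
        rw [← hs, AffineMap.apply_lineMap, AffineMap.lineMap_apply_module, hm',
          hzero' i hm]
        simp
      have P0 := routhWeightSum_pos hx i j
      have P2 := routhWeightSum_pos hx i (j + 1)
      have e1 := (c1 1 (by omega)).symm.trans (c2 0 (by omega))
      have e2 := (c1 (j + 1) (by omega)).symm.trans (c2 j (by omega))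
      have hw1 : routhWeight x i 1 = x i := by simp [routhWeight]
      rw [if_pos (by omega), if_neg (by omega), if_pos (by omega), hw1, routhWeight_zero] at e1
      rw [if_neg (by omega), if_pos rfl, if_pos le_rfl] at e2
      have ht' : t = (1 - t) * routhWeight x i (j + 1) / routhWeightSum x i j := by
        rw [routhWeight_succ']
        have : t = ((1 - s) * (1 / routhWeightSum x (i + 1) j)) * routhWeight x (i + 1) j := by
          linear_combination e2
        rw [← e1] at this
        linear_combination this
      have ht1 : (1 - t) * routhWeightSum x i (j + 1) = routhWeightSum x i j := by
        rw [routhWeightSum_succ]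
        field_simp at ht'
        linear_combination -ht'
      have ht2 : 1 - t = routhWeightSum x i j / routhWeightSum x i (j + 1) := by
        rw [eq_div_iff P2.ne', ht1]
      rw [c1 m hm]
      rcases lt_trichotomy m (j + 1) with h | h | h
      · rw [if_pos (by omega), if_neg (by omega), if_pos (by omega), ht2]
        field_simp
        ring
      · subst h
        rw [if_neg (by omega), if_pos rfl, if_pos le_rfl]
        rw [eq_div_iff P2.ne']
        linear_combination routhWeightSum_succ (x := x) i j - ht1
      · rw [if_neg (by omega), if_neg (by omega), if_neg (by omega)]
        simp

/-- `T_i` in barycentric coordinates. -/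
lemma mem_closedHalfspace_iff (hn : 2 ≤ n) (B : AffineBasis (ZMod n) ℝ E) {i : ZMod n}
    {r : ℝ} (hr : 0 < r) (P : E) :
    P ∈ closedHalfspace
        ({AffineMap.lineMap (B i) (B (i + 1)) (r / (1 + r))} ∪ B '' {m | m ≠ i ∧ m ≠ i + 1})
        (B i) ↔
      B.coord (i + 1) P ≤ r * B.coord i P := by
  have hne : i ≠ i + 1 := by
    have := ZMod.add_natCast_inj (k := i) (a := 0) (b := 1) (by omega) (by omega)
    simpa using this
  set g : E →ᵃ[ℝ] ℝ := r • B.coord i - B.coord (i + 1) with hg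
  have hgP : ∀ P, g P = r * B.coord i P - B.coord (i + 1) P := fun P => by simp [hg]
  constructor
  · intro h
    have := h g ?_ ?_
    · rw [hgP] at this; linarith
    · rintro Q (rfl | ⟨m, ⟨h1, h2⟩, rfl⟩)
      · rw [AffineMap.apply_lineMap, AffineMap.lineMap_apply_module, hgP, hgP]
        simp only [AffineBasis.coord_apply, if_neg hne, if_neg hne.symm, if_true, smul_eq_mul]
        field_simp
        ring
      · rw [hgP]
        simp [h1.symm, h2.symm]
    · rw [hgP]
      simp [hne.symm, hr.le]
  · intro h f hf hfi
    have h1 := hf _ (Or.inl rfl)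
    rw [AffineMap.apply_lineMap, AffineMap.lineMap_apply_module] at h1
    simp only [smul_eq_mul] at h1
    field_simp at h1
    have h2 : f (B i) = -(r * f (B (i + 1))) := by linarith
    have key : r • f = f (B i) • g := by
      refine AffineMap.ext_on B.tot ?_
      rintro _ ⟨m, rfl⟩
      simp only [AffineMap.coe_smul, Pi.smul_apply, smul_eq_mul, hgP, AffineBasis.coord_apply]
      by_cases hmi : m = i
      · subst hmi
        rw [if_pos rfl, if_neg hne.symm]; ring
      · by_cases hmi' : m = i + 1
        · subst hmi'
          rw [if_neg hne, if_pos rfl]; linarith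
        · rw [if_neg (Ne.symm hmi), if_neg (Ne.symm hmi'), hf _ (Or.inr ⟨m, ⟨hmi, hmi'⟩, rfl⟩)]
          ring
    have hP : r * f P = f (B i) * g P := by
      simpa using congrArg (fun φ : E →ᵃ[ℝ] ℝ => φ P) key
    have : 0 ≤ r * f P := by
      rw [hP, hgP]
      exact mul_nonneg hfi (by linarith)
    exact nonneg_of_mul_nonneg_right this hr

end Coordinates

section AffineImage

variable {E : Type*} [NormedAddCommGroup E] [NormedSpace ℝ E]

lemma MeasureTheory.Measure.addHaar_image_affineMap [FiniteDimensional ℝ E]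
    [MeasurableSpace E] [BorelSpace E] (μ : Measure E) [μ.IsAddHaarMeasure]
    (F : E →ᵃ[ℝ] E) (s : Set E) :
    μ (F '' s) = ENNReal.ofReal |LinearMap.det F.linear| * μ s := by
  have : F '' s = (fun y => y + F 0) '' (F.linear '' s) := by
    rw [Set.image_image, AffineMap.decomp F]
    simp
  rw [this, Set.image_add_right, measure_preimage_add_right, addHaar_image_linearMap]

lemma AffineBasis.exists_affineMap {ι : Type*} [Fintype ι] (B : AffineBasis ι ℝ E)
    (q : ι → E) : ∃ F : E →ᵃ[ℝ] E, ∀ i, F (B i) = q i := by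
  classical
  refine ⟨(Fintype.linearCombination ℝ q).toAffineMap.comp B.coords, fun i => ?_⟩
  simp [Fintype.linearCombination_apply, AffineBasis.coord_apply]

/-- The determinant of an affine map that is triangular in barycentric coordinates. -/
lemma AffineBasis.det_linear_of_triangular {n : ℕ} [NeZero n] (B : AffineBasis (ZMod n) ℝ E)
    (k : ZMod n) (F : E →ᵃ[ℝ] E) (hF : F (B k) = B k)
    (htri : ∀ a < n, ∀ c < a,
      B.coord (k + (a : ZMod n)) (F (B (k + (c : ZMod n)))) = 0) :
    LinearMap.det F.linear =
      ∏ m ∈ Finset.range (n - 1),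
        B.coord (k + ((m + 1 : ℕ) : ZMod n)) (F (B (k + ((m + 1 : ℕ) : ZMod n)))) := by
  have hne : ∀ r : Fin (n - 1), k + (((r : ℕ) + 1 : ℕ) : ZMod n) ≠ k := fun r h => by
    have := (ZMod.add_natCast_inj (k := k) (a := r + 1) (b := 0) (by omega)
      (NeZero.pos n)).1
      (by simpa using h)
    omega
  have hbij : Function.Bijective
      (fun r : Fin (n - 1) => (⟨k + (((r : ℕ) + 1 : ℕ) : ZMod n), hne r⟩ : {j // j ≠ k})) := by
    constructor
    · intro r s h
      have := (ZMod.add_natCast_inj (k := k) (a := r + 1) (b := s + 1) (by omega)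
        (by omega)).1 (Subtype.ext_iff.1 h)
      exact Fin.ext (by omega)
    · rintro ⟨j, hj⟩
      obtain ⟨m, hm, rfl⟩ := ZMod.exists_lt_eq_add_natCast k j
      rcases m with _ | m
      · simp at hj
      · exact ⟨⟨m, by omega⟩, rfl⟩
  set v := (B.basisOf k).reindex (Equiv.ofBijective _ hbij).symm with hv
  have hvr : ∀ r, v r = B (k + (((r : ℕ) + 1 : ℕ) : ZMod n)) - B k := fun r => by
    simp [hv]
  have hlin : ∀ r c : Fin (n - 1), (B.coord (k + (((r : ℕ) + 1 : ℕ) : ZMod n))).linear (v c) =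
      if c = r then 1 else 0 := by
    intro r c
    rw [hvr, ← vsub_eq_sub, AffineMap.linearMap_vsub, B.coord_apply_ne (hne r), vsub_eq_sub,
      sub_zero, B.coord_apply]
    simp only [ZMod.add_natCast_inj (k := k) (show (r : ℕ) + 1 < n by omega)
      (show (c : ℕ) + 1 < n by omega), Fin.ext_iff, add_left_inj, eq_comm]
  have hrepr : ∀ r y, v.repr y r = (B.coord (k + (((r : ℕ) + 1 : ℕ) : ZMod n))).linear y := by
    intro r y
    have : v.coord r = (B.coord (k + (((r : ℕ) + 1 : ℕ) : ZMod n))).linear := by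
      refine v.ext fun c => ?_
      rw [hlin, Module.Basis.coord_apply, Module.Basis.repr_self, Finsupp.single_apply]
    rw [← this, Module.Basis.coord_apply]
  have hentry : ∀ r c, LinearMap.toMatrix v v F.linear r c =
      B.coord (k + (((r : ℕ) + 1 : ℕ) : ZMod n))
        (F (B (k + (((c : ℕ) + 1 : ℕ) : ZMod n)))) := by
    intro r c
    rw [LinearMap.toMatrix_apply, hrepr, hvr, ← vsub_eq_sub, AffineMap.linearMap_vsub,
      AffineMap.linearMap_vsub, hF, B.coord_apply_ne (hne r), vsub_eq_sub, sub_zero]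
  rw [← LinearMap.det_toMatrix v, Matrix.det_of_isUpperTriangular, Finset.prod_range]
  · exact Finset.prod_congr rfl fun r _ => hentry r r
  · intro r c hrc
    rw [hentry]
    exact htri _ (by omega) _ (by simpa using hrc)

end AffineImage

section Block

variable {n : ℕ} {x : ZMod n → ℝ}

/-- A point of the block region is a convex combination of the vertices of the block simplex. -/
lemma mem_convexHull_of_coord_le {E : Type*} [AddCommGroup E] [Module ℝ E]
    (hx : ∀ i, 0 < x i) (k : ZMod n) {l : ℕ} (hl : l + 1 ≤ n - 1)
    {e q : ℕ → E} {s : Set E} (hs : ∀ m < n, q m ∈ s)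
    (hq : ∀ j ≤ l + 1, routhWeightSum x k j • q j =
      ∑ b ∈ Finset.range (j + 1), routhWeight x k b • e b)
    (hq' : ∀ m, l + 2 ≤ m → q m = e m)
    {c : ℕ → ℝ} (hc : ∀ m < n, 0 ≤ c m) (hsum : ∑ m ∈ Finset.range n, c m = 1)
    (hle : ∀ i < l + 1, c (i + 1) ≤ x (k + (i : ZMod n)) * c i) :
    ∑ m ∈ Finset.range n, c m • e m ∈ convexHull ℝ s := by
  set u : ℕ → ℝ := fun m => if m ≤ l + 1 then c m / routhWeight x k m else 0 with hu
  set w : ℕ → ℝ := fun m => if m ≤ l + 1 then (u m - u (m + 1)) * routhWeightSum x k m else c m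
    with hw
  have hln : l + 2 ≤ n := by omega
  have hu0 : u (l + 2) = 0 := by simp [hu]
  have hmono : ∀ m ≤ l + 1, u (m + 1) ≤ u m := by
    intro m hm
    have p0 := routhWeight_pos hx k m
    rcases Nat.lt_or_ge m (l + 1) with h | h
    · simp only [hu, if_pos hm, if_pos (show m + 1 ≤ l + 1 from h)]
      rw [div_le_div_iff₀ (routhWeight_pos hx _ _) p0, routhWeight_succ]
      nlinarith [hle m h]
    · obtain rfl : m = l + 1 := le_antisymm hm h
      rw [hu0]
      simp only [hu, if_pos le_rfl]
      exact div_nonneg (hc _ (by omega)) p0.le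
  have hw0 : ∀ m ∈ Finset.range n, 0 ≤ w m := by
    intro m hm
    by_cases h : m ≤ l + 1
    · simp only [hw, if_pos h]
      exact mul_nonneg (sub_nonneg.2 (hmono m h)) (routhWeightSum_pos hx _ _).le
    · simp only [hw, if_neg h]
      exact hc m (Finset.mem_range.1 hm)
  have split : ∀ {M : Type _} [AddCommGroup M] [Module ℝ M] (g h : ℕ → M),
      (∀ j ≤ l + 1, routhWeightSum x k j • h j =
        ∑ b ∈ Finset.range (j + 1), routhWeight x k b • g b) →
      (∀ m, l + 2 ≤ m → h m = g m) →
      ∑ m ∈ Finset.range n, w m • h m = ∑ m ∈ Finset.range n, c m • g m := by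
    intro M _ _ g h hh hh'
    rw [← Finset.sum_range_add_sum_Ico _ hln, ← Finset.sum_range_add_sum_Ico _ hln]
    congr 1
    · have := Finset.sum_range_sub_smul_sum_range u (fun b => routhWeight x k b • g b) (l + 2)
      rw [hu0, zero_smul, sub_zero] at this
      calc _ = ∑ j ∈ Finset.range (l + 2), (u j - u (j + 1)) •
            ∑ b ∈ Finset.range (j + 1), routhWeight x k b • g b := by
            refine Finset.sum_congr rfl fun j hj => ?_
            have hj' : j ≤ l + 1 := Nat.lt_succ_iff.1 (Finset.mem_range.1 hj)
            simp only [hw, if_pos hj']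
            rw [mul_smul, hh j hj']
        _ = _ := by
            rw [this]
            refine Finset.sum_congr rfl fun j hj => ?_
            have hj' : j ≤ l + 1 := Nat.lt_succ_iff.1 (Finset.mem_range.1 hj)
            simp only [hu, if_pos hj']
            rw [smul_smul, div_mul_cancel₀ _ (routhWeight_pos hx k j).ne']
    · refine Finset.sum_congr rfl fun j hj => ?_
      have hj' := (Finset.mem_Ico.1 hj).1
      simp only [hw, if_neg (show ¬ j ≤ l + 1 by omega)]
      rw [hh' j hj']
  have hpair := split (M := E × ℝ) (fun m => (e m, 1)) (fun m => (q m, 1))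
    (fun j hj => by
      ext
      · simpa [Prod.fst_sum] using hq j hj
      · simp [Prod.snd_sum, routhWeightSum])
    (fun m hm => by rw [hq' m hm])
  have hfst := congrArg Prod.fst hpair
  have hsnd := congrArg Prod.snd hpair
  simp only [Prod.fst_sum, Prod.snd_sum, Prod.smul_mk, smul_eq_mul, mul_one] at hfst hsnd
  rw [← hfst]
  exact (convex_convexHull ℝ s).sum_mem hw0 (hsnd.trans hsum) fun m hm =>
    subset_convexHull ℝ s (hs m (Finset.mem_range.1 hm))

end Block

/-- **Proposition 1 of the paper.** For a block `B = {k, …, k+l}` of consecutive indices,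
the intersection `∩_{i∈B} T_i` is the simplex with vertices
`A^0_k, A^1_k, …, A^{l+1}_k, A^0_{k+l+2}, …, A^0_{k+n-1}` and its volume is `V(B)` times
the volume of `S`. -/
theorem routh_simplex_block
    (n : ℕ) [NeZero n] (hn : 4 ≤ n)
    (A : ℕ → ZMod n → EuclideanSpace ℝ (Fin (n - 1)))
    (x : ZMod n → ℝ) (hx : ∀ i, 0 < x i)
    (hind : AffineIndependent ℝ (A 0))
    (hseg : ∀ i, A 1 i ∈ segment ℝ (A 0 i) (A 0 (i + 1)))
    (hratio : ∀ i, dist (A 0 i) (A 1 i) = x i * dist (A 1 i) (A 0 (i + 1)))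
    (hA : ∀ (i : ZMod n) (j : ℕ), 2 ≤ j → j ≤ n - 1 →
      A j i ∈ affineSpan ℝ
          ({A (j - 1) i, A 0 (i + (j : ZMod n))} : Set (EuclideanSpace ℝ (Fin (n - 1)))) ∧
      A j i ∈ affineSpan ℝ
          ({A (j - 1) (i + 1), A 0 i} : Set (EuclideanSpace ℝ (Fin (n - 1)))))
    (k : ZMod n) (l : ℕ) (hl : l + 1 ≤ n - 1) :
    (⋂ i ∈ Finset.range (l + 1), routhPiece A (k + (i : ZMod n))) =
      convexHull ℝ
        {P : EuclideanSpace ℝ (Fin (n - 1)) |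
          (∃ j ≤ l + 1, P = A j k) ∨
          (∃ m : ℕ, l + 2 ≤ m ∧ m ≤ n - 1 ∧ P = A 0 (k + (m : ZMod n)))} ∧
    volume (⋂ i ∈ Finset.range (l + 1), routhPiece A (k + (i : ZMod n))) =
      ENNReal.ofReal (routhBlockValue x k l) *
        volume (convexHull ℝ (Set.range (A 0))) := by
  have htop : affineSpan ℝ (Set.range (A 0)) = ⊤ := by
    rw [hind.affineSpan_eq_top_iff_card_eq_finrank_add_one, ZMod.card,
      finrank_euclideanSpace_fin]
    omega
  let B : AffineBasis (ZMod n) ℝ (EuclideanSpace ℝ (Fin (n - 1))) := ⟨A 0, hind, htop⟩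
  have hB : ∀ i, B i = A 0 i := fun _ => rfl
  have hone : ∀ i, A 1 i = AffineMap.lineMap (A 0 i) (A 0 (i + 1)) (x i / (1 + x i)) := by
    intro i
    refine eq_lineMap_of_dist_ratio (hx i) (fun h => ?_) (hseg i) (hratio i)
    have := ZMod.add_natCast_inj (k := i) (a := 0) (b := 1) (by omega) (by omega)
    exact absurd (hind.injective h) (by simpa using this)
  have hcoord : ∀ {j : ℕ}, j ≤ n - 1 → ∀ {m : ℕ}, m < n →
      B.coord (k + (m : ZMod n)) (A j k) =
        if m ≤ j then routhWeight x k m / routhWeightSum x k j else 0 :=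
    fun hj _ hm => coord_routh_point (by omega) hx B hB hone hA hj k hm
  have hpiece : ∀ i P, P ∈ routhPiece A i ↔
      B.coord (i + 1) P ≤ x i * B.coord i P ∧ ∀ j, 0 ≤ B.coord j P := by
    intro i P
    rw [routhPiece, Set.mem_inter_iff, hone,
      ← mem_closedHalfspace_iff (by omega) B (hx i) P]
    have := B.convexHull_eq_nonneg_coord
    rw [show Set.range (A 0) = Set.range B from rfl, this]
    rfl
  set q : ℕ → EuclideanSpace ℝ (Fin (n - 1)) :=
    fun m => if m ≤ l + 1 then A m k else A 0 (k + (m : ZMod n)) with hq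
  obtain ⟨F, hF⟩ := B.exists_affineMap fun i => q (i - k).val
  have hFq : ∀ m < n, F (B (k + (m : ZMod n))) = q m := by
    intro m hm
    rw [hF, add_sub_cancel_left, ZMod.val_cast_of_lt hm]
  have hqcoord : ∀ m < n, ∀ a < n, B.coord (k + (a : ZMod n)) (q m) =
      if m ≤ l + 1 then (if a ≤ m then routhWeight x k a / routhWeightSum x k m else 0)
      else if a = m then 1 else 0 := by
    intro m hm a ha
    by_cases h : m ≤ l + 1
    · simp only [hq, if_pos h]
      exact hcoord (by omega) ha
    · simp only [hq, if_neg h, ← hB, B.coord_apply, ZMod.add_natCast_inj ha hm]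
  have hset : {P : EuclideanSpace ℝ (Fin (n - 1)) | (∃ j ≤ l + 1, P = A j k) ∨
      (∃ m : ℕ, l + 2 ≤ m ∧ m ≤ n - 1 ∧ P = A 0 (k + (m : ZMod n)))} =
      F '' Set.range (A 0) := by
    ext P
    constructor
    · rintro (⟨j, hj, rfl⟩ | ⟨m, hm, hm', rfl⟩)
      · exact ⟨_, ⟨k + (j : ZMod n), rfl⟩, by
          rw [← hB, hFq j (by omega)]; simp only [hq, if_pos hj]⟩
      · exact ⟨_, ⟨k + (m : ZMod n), rfl⟩, by
          rw [← hB, hFq m (by omega)]; simp only [hq, if_neg (show ¬ m ≤ l + 1 by omega), hB]⟩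
    · rintro ⟨_, ⟨i, rfl⟩, rfl⟩
      obtain ⟨m, hm, rfl⟩ := ZMod.exists_lt_eq_add_natCast k i
      rw [← hB, hFq m hm]
      by_cases h : m ≤ l + 1
      · exact Or.inl ⟨m, h, by simp only [hq, if_pos h]⟩
      · exact Or.inr ⟨m, by omega, by omega, by simp only [hq, if_neg h]⟩
  have hqmem : ∀ m < n, q m ∈ F '' Set.range (A 0) := fun m hm =>
    ⟨_, ⟨k + (m : ZMod n), rfl⟩, hFq m hm⟩
  have hinter : (⋂ i ∈ Finset.range (l + 1), routhPiece A (k + (i : ZMod n))) =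
      convexHull ℝ (F '' Set.range (A 0)) := by
    apply Set.Subset.antisymm
    · intro P hP
      simp only [Set.mem_iInter, hpiece, Finset.mem_range] at hP
      have hnonneg := (hP 0 (by omega)).2
      have hexpand : ∀ P, P = ∑ m ∈ Finset.range n,
          B.coord (k + (m : ZMod n)) P • A 0 (k + (m : ZMod n)) := fun P => by
        rw [← ZMod.sum_univ_eq_sum_range_add k fun i => B.coord i P • A 0 i]
        exact (B.linear_combination_coord_eq_self P).symm
      rw [hexpand P]
      refine mem_convexHull_of_coord_le hx k hl hqmem ?_ ?_ (fun m _ => hnonneg _) ?_ ?_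
      · intro j hj
        have hjn : j + 1 ≤ n := by omega
        simp only [hq, if_pos hj]
        conv_lhs => rw [hexpand (A j k)]
        rw [← Finset.sum_range_add_sum_Ico _ hjn, smul_add, Finset.smul_sum, Finset.smul_sum]
        rw [Finset.sum_eq_zero (s := Finset.Ico (j + 1) n), add_zero]
        · refine Finset.sum_congr rfl fun b hb => ?_
          have hb' := Finset.mem_range.1 hb
          rw [hcoord (by omega) (by omega), if_pos (by omega), smul_smul,
            mul_div_cancel₀ _ (routhWeightSum_pos hx k j).ne']
        · intro b hb
          have hb' := Finset.mem_Ico.1 hb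
          rw [hcoord (by omega) hb'.2, if_neg (by omega), zero_smul, smul_zero]
      · intro m hm
        simp only [hq, if_neg (show ¬ m ≤ l + 1 by omega)]
      · rw [← ZMod.sum_univ_eq_sum_range_add k fun i => B.coord i P]
        exact B.sum_coord_apply_eq_one P
      · intro i hi
        have := (hP i hi).1
        rwa [add_assoc, ← Nat.cast_add_one] at this
    · refine Set.subset_iInter₂ fun i hi => ?_
      have hi' := Finset.mem_range.1 hi
      have hconv : Convex ℝ (routhPiece A (k + (i : ZMod n))) := by
        have : routhPiece A (k + (i : ZMod n)) =
            (x (k + (i : ZMod n)) • B.coord (k + (i : ZMod n)) -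
              B.coord (k + (i : ZMod n) + 1)) ⁻¹' Set.Ici 0 ∩ convexHull ℝ (Set.range B) := by
          ext P
          rw [hpiece, B.convexHull_eq_nonneg_coord]
          simp
        rw [this]
        exact ((convex_Ici 0).affine_preimage _).inter (convex_convexHull ℝ _)
      refine convexHull_min ?_ hconv
      rintro _ ⟨_, ⟨j, rfl⟩, rfl⟩
      obtain ⟨m, hm, rfl⟩ := ZMod.exists_lt_eq_add_natCast k j
      rw [← hB, hFq m hm, hpiece]
      have hP := routhWeightSum_pos hx k m
      constructor
      · rw [add_assoc, ← Nat.cast_add_one, hqcoord m hm _ (by omega), hqcoord m hm _ (by omega),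
          routhWeight_succ]
        have hw := routhWeight_pos hx k i
        have hxi := hx (k + (i : ZMod n))
        split_ifs
        · exact le_of_eq (by ring)
        · omega
        · positivity
        · simp
        all_goals first | omega | simp
      · intro j
        obtain ⟨a, ha, rfl⟩ := ZMod.exists_lt_eq_add_natCast k j
        rw [hqcoord m hm a ha]
        have hw := routhWeight_pos hx k a
        split_ifs <;> positivity
  rw [hset]
  refine ⟨hinter, ?_⟩
  have hdet : LinearMap.det F.linear = routhBlockValue x k l := by
    rw [B.det_linear_of_triangular k F]
    · rw [routhBlockValue_eq, ← Finset.prod_subset (Finset.range_mono hl)]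
      · refine Finset.prod_congr rfl fun m hm => ?_
        have hm' := Finset.mem_range.1 hm
        rw [hFq _ (by omega), hqcoord _ (by omega) _ (by omega), if_pos (by omega),
          if_pos le_rfl]
      · intro m hm hm'
        rw [Finset.mem_range] at hm hm'
        rw [hFq _ (by omega), hqcoord _ (by omega) _ (by omega), if_neg (by omega), if_pos rfl]
    · have h0 := hFq 0 (by omega)
      rw [Nat.cast_zero, add_zero] at h0
      rw [h0, hB]
      simp [hq]
    · intro a ha c hca
      rw [hFq c (by omega), hqcoord c (by omega) a ha, if_neg (show ¬ a ≤ c by omega),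
        if_neg hca.ne', ite_self]
  rw [hinter, ← AffineMap.image_convexHull, Measure.addHaar_image_affineMap, hdet, abs_of_nonneg]
  rw [routhBlockValue_eq]
  exact Finset.prod_nonneg fun m _ =>
    (div_pos (routhWeight_pos hx _ _) (routhWeightSum_pos hx _ _)).le
end
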